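/- arXiv:2201.02888 — 3 statements merged into one kernel-verified Lean document; each statement's English description precedes it below -/
import Mathlib

section
/- There exists a Borel linear subspace L of ℝ^ω (with L ≠ ℝ^ω) such that L is Haar-meager in ℝ^ω, L is Haar-null in ℝ^ω, and L cannot be covered by countably many closed Haar-meager subsets of ℝ^ω (i.e., for every sequence (F_n) of closed Haar-meager subsets of ℝ^ω, L is not contained in ⋃_n F_n). -/
open Set Filter Topology Pointwise MeasureTheory

/-- A Borel set `A` in a topological Abelian group is *Haar-meager* if there is a continuous
map `f` from the Cantor cube `ℕ → Bool` such that `f ⁻¹' (A + x)` is meager for every `x`. -/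
def HaarMeager {X : Type*} [TopologicalSpace X] [AddCommGroup X] (A : Set X) : Prop :=
  ∃ f : (ℕ → Bool) → X, Continuous f ∧ ∀ x : X, IsMeagre (f ⁻¹' ((fun a => a + x) '' A))

/-- A set `A` is *Haar-null* if there is a Borel probability measure `μ` on `X` such that
`μ (A + x) = 0` for every `x ∈ X`. -/
def HaarNull {X : Type*} [MeasurableSpace X] [AddCommGroup X] (A : Set X) : Prop :=
  ∃ μ : Measure X, IsProbabilityMeasure μ ∧ ∀ x : X, μ ((fun a => a + x) '' A) = 0

/-- A subset `T` of the Cantor cube is *thin* if for every coordinate `n`, any two elements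
of `T` agreeing at all coordinates except possibly `n` are equal. -/
def IsThinSet (T : Set (ℕ → Bool)) : Prop :=
  ∀ n : ℕ, ∀ s ∈ T, ∀ t ∈ T, (∀ m : ℕ, m ≠ n → s m = t m) → s = t

/-- A set `A` is *Haar-thin* if there is a continuous map `f` from the Cantor cube such that
`f ⁻¹' (A + x)` is thin for every `x`. -/
def HaarThin {X : Type*} [TopologicalSpace X] [AddCommGroup X] (A : Set X) : Prop :=
  ∃ f : (ℕ → Bool) → X, Continuous f ∧ ∀ x : X, IsThinSet (f ⁻¹' ((fun a => a + x) '' A))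

/-- A set `A` is *null-finite* if there is a null sequence `(x n)` such that
`{n | x n + y ∈ A}` is finite for every `y`. -/
def NullFinite {X : Type*} [TopologicalSpace X] [AddCommGroup X] (A : Set X) : Prop :=
  ∃ x : ℕ → X, Tendsto x atTop (nhds 0) ∧ ∀ y : X, {n : ℕ | x n + y ∈ A}.Finite

/-- A set `A` is *Haar-open* if for every compact `K` and `p ∈ K` there is `x` such that
`K ∩ (A + x)` is a neighborhood of `p` in the subspace `K`. -/
def HaarOpen {X : Type*} [TopologicalSpace X] [AddCommGroup X] (A : Set X) : Prop :=
  ∀ K : Set X, IsCompact K → ∀ p ∈ K, ∃ x : X,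
    K ∩ ((fun a => a + x) '' A) ∈ nhdsWithin p K

/-- A subset of the Cantor cube with at most one point is meager. -/
theorem isMeagre_of_subsingleton_cantor {S : Set (ℕ → Bool)} (hS : S.Subsingleton) :
    IsMeagre S := by
  rcases hS.eq_empty_or_singleton with rfl | ⟨b, rfl⟩
  · exact IsMeagre.empty
  refine IsNowhereDense.isMeagre ((isClosed_singleton.isNowhereDense_iff).2 ?_)
  by_contra hne
  obtain ⟨c, hc⟩ := nonempty_iff_ne_empty.2 hne
  obtain ⟨_, ⟨a, n, rfl⟩, hcU, hUsub⟩ :=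
    (PiNat.isTopologicalBasis_cylinders (fun _ : ℕ => Bool)).exists_subset_of_mem_open hc
      isOpen_interior
  have hcb : c = b := mem_singleton_iff.1 (interior_subset hc)
  have hflip : Function.update c n (!c n) ∈ PiNat.cylinder a n := by
    rw [PiNat.mem_cylinder_iff] at hcU ⊢
    intro i hi
    rw [Function.update_of_ne hi.ne]
    exact hcU i hi
  have hb : Function.update c n (!c n) = b := mem_singleton_iff.1 (interior_subset (hUsub hflip))
  have := congrFun (hb.trans hcb.symm) n
  simp at this

/-- A line not contained in a subspace meets each translate of it in at most one point. -/
theorem Submodule.smul_mem_translate_unique {E : Type*} [AddCommGroup E] [Module ℝ E]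
    {L : Submodule ℝ E} {v : E} (hv : v ∉ L) {x : E} {s t : ℝ}
    (hs : s • v ∈ (fun a => a + x) '' (L : Set E)) (ht : t • v ∈ (fun a => a + x) '' (L : Set E)) :
    s = t := by
  obtain ⟨a, ha, hax⟩ := hs
  obtain ⟨b, hb, hbx⟩ := ht
  by_contra hst
  apply hv
  have h : (s - t) • v ∈ L := by
    have : (s - t) • v = a - b := by
      rw [sub_smul, ← hax, ← hbx, add_sub_add_right_eq_sub]
    rw [this]
    exact L.sub_mem ha hb
  exact (L.smul_mem_iff (sub_ne_zero.2 hst)).1 h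

/-- A proper linear subspace is Haar-meager. -/
theorem haarMeager_of_notMem {E : Type*} [AddCommGroup E] [Module ℝ E] [TopologicalSpace E]
    [ContinuousSMul ℝ E] {L : Submodule ℝ E} {v : E} (hv : v ∉ L) :
    HaarMeager (L : Set E) := by
  obtain ⟨g, -, hg, hinj⟩ := isClosed_univ.exists_nat_bool_injection_of_not_countable
    (α := ℝ) Cardinal.not_countable_real
  refine ⟨fun b => g b • v, by fun_prop, fun x => isMeagre_of_subsingleton_cantor ?_⟩
  exact fun b hb c hc => hinj (L.smul_mem_translate_unique hv hb hc)

/-- A proper measurable linear subspace is Haar-null. -/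
theorem haarNull_of_notMem {E : Type*} [AddCommGroup E] [Module ℝ E] [MeasurableSpace E]
    [MeasurableAdd E] [MeasurableSMul ℝ E] {L : Submodule ℝ E}
    (hL : MeasurableSet (L : Set E)) {v : E} (hv : v ∉ L) : HaarNull (L : Set E) := by
  have hm : Measurable fun t : ℝ => t • v := measurable_smul_const v
  have : IsProbabilityMeasure (volume.restrict (Icc (0 : ℝ) 1)) := ⟨by simp⟩
  refine ⟨(volume.restrict (Icc (0 : ℝ) 1)).map fun t => t • v,
    Measure.isProbabilityMeasure_map hm.aemeasurable, fun x => ?_⟩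
  have hx : MeasurableSet ((fun a => a + x) '' (L : Set E)) := by
    rw [image_add_right]
    exact measurable_add_const (-x) hL
  rw [Measure.map_apply hm hx]
  refine Set.Subsingleton.measure_zero ?_ _
  exact fun s hs t ht => L.smul_mem_translate_unique hv hs ht

/-- The span of a linearly independent Borel family indexed by a standard Borel space is Borel. -/
theorem measurableSet_span_range {α E : Type*} [MeasurableSpace α] [StandardBorelSpace α]
    [AddCommGroup E] [Module ℝ E] [MeasurableSpace E] [MeasurableSpace.CountablySeparated E]
    [MeasurableAdd₂ E] [MeasurableSMul₂ ℝ E] {x : α → E} (hx : Measurable x)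
    (hli : LinearIndependent ℝ x) :
    MeasurableSet (Submodule.span ℝ (range x) : Set E) := by
  obtain ⟨e, he⟩ := exists_measurableEmbedding_real α
  let D (p : ℕ) : Set ((Fin p → ℝ) × (Fin p → α)) :=
    {d | (∀ i, d.1 i ≠ 0) ∧ StrictMono fun i => e (d.2 i)}
  let Φ (p : ℕ) (d : (Fin p → ℝ) × (Fin p → α)) : E := ∑ i, d.1 i • x (d.2 i)
  let fs (p : ℕ) (d : (Fin p → ℝ) × (Fin p → α)) : α →₀ ℝ := ∑ i, Finsupp.single (d.2 i) (d.1 i)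
  have hfs : ∀ p d, Finsupp.linearCombination ℝ x (fs p d) = Φ p d := fun p d => by
    simp [fs, Φ, map_sum]
  have hspan : (Submodule.span ℝ (range x) : Set E) = ⋃ p, Φ p '' D p := by
    apply Subset.antisymm
    · intro y hy
      rw [SetLike.mem_coe, ← Finsupp.range_linearCombination] at hy
      obtain ⟨f, rfl⟩ := hy
      let S := f.support.map ⟨e, he.injective⟩
      let g := S.orderEmbOfFin rfl
      have hg : ∀ i, ∃ a ∈ f.support, e a = g i := fun i => by
        exact Finset.mem_map.1 (S.orderEmbOfFin_mem rfl i)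
      choose a haf hae using hg
      have hmono : StrictMono fun i => e (a i) := by
        simpa only [hae] using g.strictMono
      refine mem_iUnion.2 ⟨S.card, ⟨fun i => f (a i), a⟩,
        ⟨fun i => Finsupp.mem_support_iff.1 (haf i), hmono⟩, ?_⟩
      rw [Finsupp.linearCombination_apply, Finsupp.sum]
      have hainj : Function.Injective a := fun i j hij => hmono.injective (congrArg e hij)
      have himg : f.support = Finset.univ.map ⟨a, hainj⟩ := by
        symm
        apply Finset.eq_of_subset_of_card_le
        · intro b hb
          obtain ⟨i, -, rfl⟩ := Finset.mem_map.1 hb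
          exact haf i
        · simp [S]
      rw [himg, Finset.sum_map]
      rfl
    · refine iUnion_subset fun p => ?_
      rintro _ ⟨d, -, rfl⟩
      exact Submodule.sum_mem _ fun i _ =>
        Submodule.smul_mem _ _ (Submodule.subset_span (mem_range_self _))
  rw [hspan]
  refine MeasurableSet.iUnion fun p => ?_
  have hD : MeasurableSet (D p) := by
    have hDeq : D p = (⋂ i, {d | d.1 i ≠ 0}) ∩
        ⋂ i, ⋂ j, ⋂ (_ : i < j), {d | e (d.2 i) < e (d.2 j)} := by
      ext d
      simp [D, StrictMono]
    have hem := he.measurable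
    rw [hDeq]
    refine (MeasurableSet.iInter fun i => ?_).inter
      (MeasurableSet.iInter fun i => MeasurableSet.iInter fun j => MeasurableSet.iInter fun _ => ?_)
    · exact (measurableSet_eq_fun (by fun_prop) measurable_const).compl
    · exact measurableSet_lt (by fun_prop) (by fun_prop)
  refine hD.image_of_measurable_injOn ?_ ?_
  · exact Finset.measurable_sum _ fun i _ => by fun_prop
  · rintro ⟨c, σ⟩ ⟨hc, hσ⟩ ⟨c', σ'⟩ ⟨hc', hσ'⟩ h
    dsimp only at hc hσ hc' hσ'
    have hfeq : fs p (c, σ) = fs p (c', σ') := hli (by rw [hfs, hfs, h])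
    have happ : ∀ (c : Fin p → ℝ) (σ : Fin p → α), (StrictMono fun i => e (σ i)) →
        ∀ i, fs p (c, σ) (σ i) = c i := fun c σ hσ i => by
      have hinj : Function.Injective σ := fun i j hij => hσ.injective (congrArg e hij)
      simp only [fs, Finsupp.finsetSum_apply]
      rw [Finset.sum_eq_single i]
      · simp
      · exact fun j _ hj => Finsupp.single_eq_of_ne fun h => hj (hinj h).symm
      · simp
    have hsupp : ∀ (c : Fin p → ℝ) (σ : Fin p → α) (a : α), fs p (c, σ) a ≠ 0 → a ∈ range σ :=
      fun c σ a ha => by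
        by_contra hna
        refine ha ?_
        simp only [fs, Finsupp.finsetSum_apply]
        exact Finset.sum_eq_zero fun i _ => Finsupp.single_eq_of_ne fun h => hna ⟨i, h.symm⟩
    have hrange : range (fun i => e (σ i)) = range (fun i => e (σ' i)) := by
      apply Subset.antisymm
      · rintro _ ⟨i, rfl⟩
        obtain ⟨j, hj⟩ := hsupp c' σ' (σ i) (by rw [← hfeq, happ c σ hσ]; exact hc i)
        exact ⟨j, congrArg e hj⟩
      · rintro _ ⟨i, rfl⟩
        obtain ⟨j, hj⟩ := hsupp c σ (σ' i) (by rw [hfeq, happ c' σ' hσ']; exact hc' i)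
        exact ⟨j, congrArg e hj⟩
    have hσeq : σ = σ' := by
      funext i
      exact he.injective (congrFun ((hσ.range_inj hσ').1 hrange) i)
    subst hσeq
    refine Prod.ext (funext fun i => ?_) rfl
    exact (happ c σ hσ i).symm.trans ((congrArg (· (σ i)) hfeq).trans (happ c' σ hσ' i))

namespace BoxFamily

/-- Natural numbers as codes for finitely supported sequences of pairs in `ℚ × ℕ`. -/
def entry (n i : ℕ) : ℚ × ℕ :=
  ((Encodable.decode n.unpair.2 : Option (List (ℚ × ℕ))).getD []).getD i (0, 0)

theorem entry_zero (i : ℕ) : entry 0 i = (0, 0) := by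
  simp [entry]

theorem exists_entry_eq (g : ℕ → ℚ × ℕ) (N : ℕ) : ∃ n, N ≤ n ∧ ∀ i < N, entry n i = g i := by
  refine ⟨Nat.pair N (Encodable.encode ((List.range N).map g)), Nat.left_le_pair _ _,
    fun i hi => ?_⟩
  simp [entry, hi]

/-- The first coordinate treated at stage `k`. -/
def start (σ : ℕ → ℕ) (k : ℕ) : ℕ := ∑ j ∈ Finset.range k, (σ j + 1)

theorem start_succ (σ : ℕ → ℕ) (k : ℕ) : start σ (k + 1) = start σ k + (σ k + 1) :=
  Finset.sum_range_succ _ _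

theorem strictMono_start (σ : ℕ → ℕ) : StrictMono (start σ) :=
  strictMono_nat_of_lt_succ fun k => by rw [start_succ]; omega

theorem start_congr {σ τ : ℕ → ℕ} {k : ℕ} (h : ∀ j < k, σ j = τ j) : start σ k = start τ k :=
  Finset.sum_congr rfl fun j hj => by rw [h j (Finset.mem_range.1 hj)]

/-- The stage at which the coordinate `i` is treated. -/
def stage (σ : ℕ → ℕ) (i : ℕ) : ℕ := Nat.findGreatest (fun k => start σ k ≤ i) i

theorem start_stage_le (σ : ℕ → ℕ) (i : ℕ) : start σ (stage σ i) ≤ i :=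
  Nat.findGreatest_spec (P := fun k => start σ k ≤ i) (Nat.zero_le i) (by simp [start])

theorem le_stage {σ : ℕ → ℕ} {i k : ℕ} (h : start σ k ≤ i) : k ≤ stage σ i :=
  Nat.le_findGreatest (((strictMono_start σ).le_apply).trans h) h

theorem stage_le (σ : ℕ → ℕ) (i : ℕ) : stage σ i ≤ i := Nat.findGreatest_le i

theorem lt_start_stage_succ (σ : ℕ → ℕ) (i : ℕ) : i < start σ (stage σ i + 1) := by
  by_contra! h
  have := le_stage h
  omega

theorem stage_eq {σ : ℕ → ℕ} {i k : ℕ} (h : start σ k ≤ i) (h' : i < start σ (k + 1)) :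
    stage σ i = k := by
  refine le_antisymm ?_ (le_stage h)
  have := (strictMono_start σ).lt_iff_lt.1 ((start_stage_le σ i).trans_lt h')
  omega

theorem stage_congr {σ τ : ℕ → ℕ} {i : ℕ} (h : ∀ j ≤ stage σ i, σ j = τ j) :
    stage τ i = stage σ i := by
  apply stage_eq
  · rw [← start_congr fun j hj => h j hj.le]
    exact start_stage_le σ i
  · rw [← start_congr fun j hj => h j (Nat.lt_succ_iff.1 hj)]
    exact lt_start_stage_succ σ i

/-- The code of the first `k` terms of `σ`, the coordinate `i` and the parameter `m`. -/
def code (σ : ℕ → ℕ) (k i m : ℕ) : ℕ :=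
  Nat.pair (Encodable.encode ((List.range k).map σ)) (m + i)

theorem le_code (σ : ℕ → ℕ) (k i m : ℕ) : m + i ≤ code σ k i m := Nat.right_le_pair _ _

theorem code_congr {σ τ : ℕ → ℕ} {k : ℕ} (h : ∀ j < k, σ j = τ j) (i m : ℕ) :
    code σ k i m = code τ k i m := by
  have : (List.range k).map σ = (List.range k).map τ :=
    List.map_congr_left fun j hj => h j (List.mem_range.1 hj)
  rw [code, this, code]

theorem eq_of_code_eq {σ τ : ℕ → ℕ} {k k' i i' m m' : ℕ}
    (h : code σ k i m = code τ k' i' m') {j : ℕ} (hj : j < k) : σ j = τ j := by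
  have hl := Encodable.encode_injective (Nat.pair_eq_pair.1 h).1
  have hk : k = k' := by simpa using congrArg List.length hl
  subst hk
  exact List.map_inj_left.1 hl j (List.mem_range.2 hj)

/-- The point of `[-r, r]` closest to `q`. -/
def clip (r q : ℝ) : ℝ := max (-r) (min r q)

theorem abs_clip_le {r : ℝ} (hr : 0 ≤ r) (q : ℝ) : |clip r q| ≤ r :=
  abs_le.2 ⟨le_max_left _ _, max_le (by linarith) (min_le_left _ _)⟩

theorem clip_of_abs_le {r q : ℝ} (h : |q| ≤ r) : clip r q = q := by
  rw [clip, min_eq_right (abs_le.1 h).2, max_eq_right (abs_le.1 h).1]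

theorem clip_zero {r : ℝ} (hr : 0 ≤ r) : clip r 0 = 0 := clip_of_abs_le (by simpa)

theorem continuous_clip (r : ℝ) : Continuous (clip r) := by
  unfold clip
  fun_prop

/-- The code attached to the coordinate `i` of the point with address `σ`. -/
def coord (σ : ℕ → ℕ) (i : ℕ) : ℕ :=
  code σ (stage σ i) i (entry (σ (stage σ i)) i).2

/-- The value given to the coordinate `i` at its stage. -/
noncomputable def base (σ : ℕ → ℕ) (i : ℕ) : ℝ :=
  ((coord σ i + 4).factorial : ℝ) +
    clip (((entry (σ (stage σ i)) i).2 + i : ℕ) : ℝ) (entry (σ (stage σ i)) i).1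

/-- The correction of the coordinate `i` at a stage `k` after its own. -/
noncomputable def correction (σ : ℕ → ℕ) (i k : ℕ) : ℝ :=
  if i < start σ k then clip ((1 / 2) ^ k) (entry (σ k) i).1 else 0

/-- The family of points of `ℝ^ω` indexed by their addresses. -/
noncomputable def point (σ : ℕ → ℕ) (i : ℕ) : ℝ := base σ i + ∑' k, correction σ i k

theorem base_congr {σ τ : ℕ → ℕ} {i : ℕ} (h : ∀ j ≤ stage σ i, σ j = τ j) :
    base τ i = base σ i := by
  rw [base, base, coord, coord, stage_congr h, ← h _ le_rfl, code_congr fun j hj => h j hj.le]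

theorem correction_congr {σ τ : ℕ → ℕ} {i k : ℕ} (h : ∀ j ≤ k, σ j = τ j) :
    correction τ i k = correction σ i k := by
  rw [correction, correction, start_congr fun j hj => h j hj.le, h k le_rfl]

theorem abs_correction_le (σ : ℕ → ℕ) (i k : ℕ) : |correction σ i k| ≤ (1 / 2) ^ k := by
  unfold correction
  split_ifs
  · exact abs_clip_le (by positivity) _
  · simp

theorem correction_eq_zero {σ : ℕ → ℕ} {k : ℕ} (h : σ k = 0) (i : ℕ) : correction σ i k = 0 := by
  simp [correction, h, entry_zero, clip_zero]

theorem summable_correction (σ : ℕ → ℕ) (i : ℕ) : Summable (correction σ i) :=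
  Summable.of_norm_bounded summable_geometric_two fun k => abs_correction_le σ i k

theorem abs_tsum_correction_le (σ : ℕ → ℕ) (i : ℕ) : |∑' k, correction σ i k| ≤ 2 := by
  rw [← Real.norm_eq_abs]
  exact tsum_of_norm_bounded hasSum_geometric_two fun k => abs_correction_le σ i k

theorem continuous_of_agree {Y : Type*} [TopologicalSpace Y] {G : (ℕ → ℕ) → Y} (n : ℕ)
    (h : ∀ σ τ, (∀ j ≤ n, σ j = τ j) → G τ = G σ) : Continuous G := by
  refine IsLocallyConstant.continuous ((IsLocallyConstant.iff_eventually_eq G).2 fun σ => ?_)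
  filter_upwards [(PiNat.isOpen_cylinder _ σ (n + 1)).mem_nhds (PiNat.self_mem_cylinder σ _)]
    with τ hτ
  exact h σ τ fun j hj => (PiNat.mem_cylinder_iff.1 hτ j (Nat.lt_succ_of_le hj)).symm

theorem continuous_point : Continuous point := by
  refine continuous_pi fun i => ?_
  refine Continuous.add ?_ ?_
  · exact continuous_of_agree i fun σ τ h => base_congr fun j hj => h j (hj.trans (stage_le σ i))
  · refine continuous_tsum (fun k => ?_) summable_geometric_two
      fun k σ => abs_correction_le σ i k
    exact continuous_of_agree k fun σ τ h => correction_congr h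

theorem le_coord (σ : ℕ → ℕ) (i : ℕ) : (entry (σ (stage σ i)) i).2 + i ≤ coord σ i :=
  le_code _ _ _ _

theorem abs_point_sub_le (σ : ℕ → ℕ) (i : ℕ) :
    |point σ i - ((coord σ i + 4).factorial : ℝ)| ≤ coord σ i + 2 := by
  have h₁ := abs_tsum_correction_le σ i
  have h₂ := abs_clip_le (Nat.cast_nonneg ((entry (σ (stage σ i)) i).2 + i) : (0 : ℝ) ≤ _)
    (entry (σ (stage σ i)) i).1
  have h₃ : (((entry (σ (stage σ i)) i).2 + i : ℕ) : ℝ) ≤ coord σ i := by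
    exact_mod_cast le_coord σ i
  have : point σ i - ((coord σ i + 4).factorial : ℝ) =
      clip (((entry (σ (stage σ i)) i).2 + i : ℕ) : ℝ) (entry (σ (stage σ i)) i).1 +
        ∑' k, correction σ i k := by
    rw [point, base]
    ring
  rw [this]
  exact (abs_add_le _ _).trans (by linarith)

theorem two_mul_le_factorial (c : ℕ) : 2 * ((c : ℝ) + 2) ≤ ((c + 4).factorial : ℝ) := by
  have h : 2 * (c + 2) ≤ (c + 4).factorial := by
    rw [Nat.factorial_succ]
    have := Nat.self_le_factorial (c + 3)
    nlinarith
  exact_mod_cast h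

theorem factorial_le_two_mul_point (σ : ℕ → ℕ) (i : ℕ) :
    ((coord σ i + 4).factorial : ℝ) ≤ 2 * |point σ i| := by
  have h₁ := (abs_le.1 (abs_point_sub_le σ i)).1
  have h₂ := two_mul_le_factorial (coord σ i)
  have h₃ := le_abs_self (point σ i)
  linarith

theorem point_le_two_mul_factorial (σ : ℕ → ℕ) (i : ℕ) :
    |point σ i| ≤ 2 * ((coord σ i + 4).factorial : ℝ) := by
  have h₁ := abs_le.1 (abs_point_sub_le σ i)
  have h₂ := two_mul_le_factorial (coord σ i)
  have h₃ : (0 : ℝ) ≤ coord σ i := Nat.cast_nonneg _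
  exact abs_le.2 ⟨by linarith, by linarith⟩

theorem le_abs_point (σ : ℕ → ℕ) (i : ℕ) : (i : ℝ) ≤ |point σ i| := by
  have h₁ := factorial_le_two_mul_point σ i
  have h₂ := two_mul_le_factorial (coord σ i)
  have h₃ : (i : ℝ) ≤ coord σ i := by
    exact_mod_cast (Nat.le_add_left _ _).trans (le_coord σ i)
  linarith

theorem mul_abs_point_le {σ τ : ℕ → ℕ} {i : ℕ} (h : coord σ i < coord τ i) :
    (i : ℝ) * |point σ i| ≤ 4 * |point τ i| := by
  have h₁ := point_le_two_mul_factorial σ i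
  have h₂ := factorial_le_two_mul_point τ i
  have h₃ : i * (coord σ i + 4).factorial ≤ (coord τ i + 4).factorial := by
    rw [Nat.factorial_succ (coord τ i + 3)]
    have hi : i ≤ coord τ i + 3 + 1 := by
      have := le_coord τ i
      omega
    exact Nat.mul_le_mul hi (Nat.factorial_le (by omega))
  have h₄ : (i : ℝ) * ((coord σ i + 4).factorial : ℝ) ≤ ((coord τ i + 4).factorial : ℝ) := by
    exact_mod_cast h₃
  have h₅ := mul_le_mul_of_nonneg_left h₁ (Nat.cast_nonneg i : (0 : ℝ) ≤ i)
  linarith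

theorem eventually_injOn_coord (S : Finset (ℕ → ℕ)) :
    ∀ᶠ i in atTop, InjOn (fun σ => coord σ i) (S : Set (ℕ → ℕ)) := by
  have hpair : ∀ σ ∈ S, ∀ τ ∈ S, ∀ᶠ i in atTop, coord σ i = coord τ i → σ = τ := by
    intro σ _ τ _
    by_cases hστ : σ = τ
    · exact Eventually.of_forall fun _ _ => hστ
    obtain ⟨n, hn⟩ := Function.ne_iff.1 hστ
    filter_upwards [eventually_ge_atTop (start σ (n + 1))] with i hi h
    exact absurd (eq_of_code_eq h (le_stage hi)) hn
  have := (eventually_all_finset S).2 fun σ hσ => (eventually_all_finset S).2 (hpair σ hσ)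
  filter_upwards [this] with i hi σ hσ τ hτ h
  exact hi σ hσ τ hτ h

/-- Nontrivial linear combinations of the family are unbounded sequences. -/
theorem exists_lt_abs_linearCombination {f : (ℕ → ℕ) →₀ ℝ} (hf : f ≠ 0) (B : ℝ) :
    ∃ i, B < |Finsupp.linearCombination ℝ point f i| := by
  classical
  have hne : f.support.Nonempty := Finsupp.support_nonempty_iff.2 hf
  obtain ⟨ρ, hρ, hmin⟩ := f.support.exists_min_image (fun σ => |f σ|) hne
  set δ := |f ρ|
  have hδ : 0 < δ := abs_pos.2 (Finsupp.mem_support_iff.1 hρ)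
  set A := ∑ σ ∈ f.support, |f σ|
  obtain ⟨i, hinj, hiA, hiB, hi⟩ := ((eventually_injOn_coord f.support).and
    ((tendsto_natCast_atTop_atTop.eventually_ge_atTop (8 * A / δ)).and
      ((tendsto_natCast_atTop_atTop.eventually_gt_atTop (2 * B / δ)).and
        (tendsto_natCast_atTop_atTop.eventually_gt_atTop (0 : ℝ))))).exists
  rw [div_le_iff₀ hδ] at hiA
  rw [div_lt_iff₀ hδ] at hiB
  obtain ⟨τ, hτ, hmax⟩ := f.support.exists_max_image (fun σ => coord σ i) hne
  have hsum : Finsupp.linearCombination ℝ point f i =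
      f τ * point τ i + ∑ σ ∈ f.support.erase τ, f σ * point σ i := by
    rw [Finset.add_sum_erase f.support (fun σ => f σ * point σ i) hτ,
      Finsupp.linearCombination_apply, Finsupp.sum, Finset.sum_apply]
    simp
  have hrest : (i : ℝ) * |∑ σ ∈ f.support.erase τ, f σ * point σ i| ≤ A * (4 * |point τ i|) := by
    calc (i : ℝ) * |∑ σ ∈ f.support.erase τ, f σ * point σ i|
        ≤ i * ∑ σ ∈ f.support.erase τ, |f σ * point σ i| :=
          mul_le_mul_of_nonneg_left (Finset.abs_sum_le_sum_abs _ _) hi.le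
      _ = ∑ σ ∈ f.support.erase τ, |f σ| * (i * |point σ i|) := by
          rw [Finset.mul_sum]
          exact Finset.sum_congr rfl fun σ _ => by rw [abs_mul]; ring
      _ ≤ ∑ σ ∈ f.support.erase τ, |f σ| * (4 * |point τ i|) := by
          refine Finset.sum_le_sum fun σ hσ => mul_le_mul_of_nonneg_left ?_ (abs_nonneg _)
          obtain ⟨hne, hσ⟩ := Finset.mem_erase.1 hσ
          exact mul_abs_point_le ((hmax σ hσ).lt_of_ne fun h => hne (hinj hσ hτ h))
      _ = (∑ σ ∈ f.support.erase τ, |f σ|) * (4 * |point τ i|) := (Finset.sum_mul _ _ _).symm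
      _ ≤ A * (4 * |point τ i|) := by
          refine mul_le_mul_of_nonneg_right ?_ (by positivity)
          exact Finset.sum_le_sum_of_subset_of_nonneg (Finset.erase_subset _ _)
            fun _ _ _ => abs_nonneg _
  have hmain : δ * |point τ i| ≤ |f τ * point τ i| := by
    rw [abs_mul]
    exact mul_le_mul_of_nonneg_right (hmin τ hτ) (abs_nonneg _)
  have htri : |f τ * point τ i| ≤ |Finsupp.linearCombination ℝ point f i| +
      |∑ σ ∈ f.support.erase τ, f σ * point σ i| := by
    have := abs_sub (Finsupp.linearCombination ℝ point f i)
      (∑ σ ∈ f.support.erase τ, f σ * point σ i)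
    rwa [hsum, add_sub_cancel_right, ← hsum] at this
  have hpoint := le_abs_point τ i
  refine ⟨i, ?_⟩
  set X := |point τ i|
  set R := |∑ σ ∈ f.support.erase τ, f σ * point σ i|
  have hR : R ≤ δ / 2 * X := by
    refine le_of_mul_le_mul_left (hrest.trans ?_) hi
    nlinarith
  nlinarith

theorem linearIndependent_point : LinearIndependent ℝ point := by
  rw [linearIndependent_iff]
  intro f hf
  by_contra hne
  obtain ⟨i, hi⟩ := exists_lt_abs_linearCombination hne 0
  simp [hf] at hi

theorem one_notMem_span : (1 : ℕ → ℝ) ∉ Submodule.span ℝ (range point) := by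
  rw [← Finsupp.range_linearCombination]
  rintro ⟨f, hf⟩
  have hne : f ≠ 0 := by
    rintro rfl
    simpa using congrFun hf 0
  obtain ⟨i, hi⟩ := exists_lt_abs_linearCombination hne 1
  simp [hf] at hi

/-- The closure of the set of points whose addresses share a given initial segment contains a
translate of every box whose first sides are small enough. -/
theorem mem_closure_image_cylinder {τ : ℕ → ℕ} {k : ℕ} (hτ : ∀ j, k ≤ j → τ j = 0)
    {y : ℕ → ℝ} (hy : ∀ i < start τ k, |y i - point τ i| ≤ (1 / 2) ^ k) (m : ℕ → ℕ)
    (hm : ∀ i, start τ k ≤ i →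
      |y i - ((code τ k i (m i) + 4).factorial : ℝ)| ≤ ((m i + i : ℕ) : ℝ)) :
    y ∈ closure (point '' PiNat.cylinder τ k) := by
  let t : ℕ → ℝ := fun i =>
    if i < start τ k then y i - point τ i else y i - ((code τ k i (m i) + 4).factorial : ℝ)
  have hrat : ∀ i, ∃ u : ℕ → ℚ, Tendsto (fun N => (u N : ℝ)) atTop (𝓝 (t i)) := fun i => by
    obtain ⟨v, hv, hlim⟩ := mem_closure_iff_seq_limit.1 (Rat.denseRange_cast (𝕜 := ℝ) (t i))
    choose u hu using hv
    exact ⟨u, by simpa only [hu] using hlim⟩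
  choose u hu using hrat
  choose n hNn hn using fun N => exists_entry_eq (fun i => (u i N, m i)) N
  let σ : ℕ → ℕ → ℕ := fun N => Function.update τ k (n N)
  have hσk : ∀ N, σ N k = n N := fun N => Function.update_self _ _ _
  have hσne : ∀ N, ∀ j ≠ k, σ N j = τ j := fun N j hj => Function.update_of_ne hj _ _
  have hstart : ∀ N, start (σ N) k = start τ k := fun N =>
    start_congr fun j hj => hσne N j hj.ne
  have hlim : Tendsto (fun N => point (σ N)) atTop (𝓝 y) := by
    refine tendsto_pi_nhds.2 fun i => ?_
    by_cases hi : i < start τ k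
    · have hpt : ∀ N > i, point (σ N) i = point τ i + clip ((1 / 2) ^ k) (u i N) := by
        intro N hN
        have hstage : stage τ i < k :=
          (strictMono_start τ).lt_iff_lt.1 ((start_stage_le τ i).trans_lt hi)
        have hcorr : correction (σ N) i =
            fun j => correction τ i j + if j = k then clip ((1 / 2) ^ k) (u i N : ℝ) else 0 := by
          funext j
          rcases lt_trichotomy j k with hj | rfl | hj
          · rw [if_neg hj.ne, add_zero]
            exact correction_congr fun l hl => (hσne N l (by omega)).symm
          · rw [if_pos rfl, correction_eq_zero (hτ j le_rfl), zero_add, correction,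
              if_pos (by rwa [hstart]), hσk, hn N i hN]
          · rw [if_neg hj.ne', add_zero, correction_eq_zero (hτ j hj.le),
              correction_eq_zero ((hσne N j hj.ne').trans (hτ j hj.le))]
        have hs : HasSum (fun j => if j = k then clip ((1 / 2) ^ k) (u i N : ℝ) else 0)
            (clip ((1 / 2) ^ k) (u i N : ℝ)) := hasSum_ite_eq k _
        rw [point, point, hcorr, (summable_correction τ i).tsum_add hs.summable, hs.tsum_eq,
          base_congr fun j hj => (hσne N j (by omega)).symm, add_assoc]
      have hy' : y i = point τ i + clip ((1 / 2) ^ k) (t i) := by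
        have ht : t i = y i - point τ i := if_pos hi
        rw [ht, clip_of_abs_le (hy i hi)]
        ring
      rw [hy']
      refine Tendsto.congr' ?_
        (tendsto_const_nhds.add (((continuous_clip ((1 / 2) ^ k)).tendsto (t i)).comp (hu i)))
      filter_upwards [eventually_gt_atTop i] with N hN
      exact (hpt N hN).symm
    · have hi' := not_lt.1 hi
      have hpt : ∀ N > i, point (σ N) i =
          ((code τ k i (m i) + 4).factorial : ℝ) + clip ((m i + i : ℕ) : ℝ) (u i N) := by
        intro N hN
        have hstage : stage (σ N) i = k := by
          refine stage_eq (by rwa [hstart]) ?_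
          rw [start_succ, hσk]
          have := hNn N
          omega
        have hcorr : correction (σ N) i = 0 := by
          funext j
          rcases le_or_gt j k with hj | hj
          · refine if_neg (not_lt.2 (((strictMono_start _).monotone hj).trans ?_))
            rwa [hstart]
          · exact correction_eq_zero ((hσne N j hj.ne').trans (hτ j hj.le)) i
        rw [point, hcorr, base, coord, hstage, hσk, hn N i hN,
          code_congr fun j hj => hσne N j hj.ne]
        simp
      have hy' : y i =
          ((code τ k i (m i) + 4).factorial : ℝ) + clip ((m i + i : ℕ) : ℝ) (t i) := by
        have ht : t i = y i - ((code τ k i (m i) + 4).factorial : ℝ) := if_neg hi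
        rw [ht, clip_of_abs_le (hm i hi')]
        ring
      rw [hy']
      refine Tendsto.congr' ?_
        (tendsto_const_nhds.add (((continuous_clip _).tendsto (t i)).comp (hu i)))
      filter_upwards [eventually_gt_atTop i] with N hN
      exact (hpt N hN).symm
  refine mem_closure_of_tendsto hlim (Eventually.of_forall fun N => mem_image_of_mem _ ?_)
  exact PiNat.mem_cylinder_iff.2 fun j hj => hσne N j hj.ne

/-- A closed set containing all points with addresses in a cylinder is not Haar-meager. -/
theorem not_haarMeager_of_image_cylinder_subset {F : Set (ℕ → ℝ)} (hF : IsClosed F) {ρ : ℕ → ℕ}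
    {k : ℕ} (h : point '' PiNat.cylinder ρ k ⊆ F) : ¬ HaarMeager F := by
  rintro ⟨f, hf, hmeager⟩
  let τ : ℕ → ℕ := fun j => if j < k then ρ j else 0
  have hτρ : PiNat.cylinder τ k = PiNat.cylinder ρ k :=
    PiNat.mem_cylinder_iff_eq.1 (PiNat.mem_cylinder_iff.2 fun j hj => if_pos hj)
  have hτ : ∀ j, k ≤ j → τ j = 0 := fun j hj => if_neg (not_lt.2 hj)
  have hfi : ∀ i, Continuous fun b => f b i := fun i => (continuous_apply i).comp hf
  have hbound : ∀ i, ∃ m : ℕ, ∀ b, |f b i| ≤ m := fun i => by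
    obtain ⟨C, hC⟩ := (isCompact_range (hfi i)).isBounded.exists_norm_le
    obtain ⟨m, hm⟩ := exists_nat_ge C
    exact ⟨m, fun b => (hC _ (mem_range_self b)).trans hm⟩
  choose m hm using hbound
  let b₀ : ℕ → Bool := fun _ => false
  let x : ℕ → ℝ := fun i =>
    if i < start τ k then f b₀ i - point τ i else -((code τ k i (m i) + 4).factorial : ℝ)
  let V : Set (ℕ → Bool) := ⋂ i ∈ Finset.range (start τ k), {b | |f b i - f b₀ i| < (1 / 2) ^ k}
  have hV : IsOpen V := isOpen_biInter_finset fun i _ =>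
    isOpen_lt (((hfi i).sub continuous_const).abs) continuous_const
  have hb₀ : b₀ ∈ V := by simp [V]
  refine not_isMeagre_of_isOpen hV ⟨b₀, hb₀⟩ ((hmeager x).mono fun b hb => ?_)
  refine ⟨f b - x, ?_, sub_add_cancel _ _⟩
  refine closure_minimal h hF ?_
  rw [← hτρ]
  refine mem_closure_image_cylinder hτ (fun i hi => ?_) m (fun i hi => ?_)
  · have hx : x i = f b₀ i - point τ i := if_pos hi
    have hbi : |f b i - f b₀ i| < (1 / 2) ^ k := mem_iInter₂.1 hb i (Finset.mem_range.2 hi)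
    have hsub : f b i - (f b₀ i - point τ i) - point τ i = f b i - f b₀ i := by ring
    rw [Pi.sub_apply, hx, hsub]
    exact hbi.le
  · have hx : x i = -((code τ k i (m i) + 4).factorial : ℝ) := if_neg (not_lt.2 hi)
    rw [Pi.sub_apply, hx, sub_neg_eq_add, add_sub_cancel_right]
    exact (hm i b).trans (by exact_mod_cast Nat.le_add_right _ _)

end BoxFamily

/-- The countable product of lines `ℝ^ω` contains a Borel linear subspace `L ≠ ℝ^ω` which is
Haar-meager and Haar-null but cannot be covered by countably many closed Haar-meager sets. -/
theorem statement0 :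
    ∃ L : Submodule ℝ (ℕ → ℝ),
      MeasurableSet (L : Set (ℕ → ℝ)) ∧
      L ≠ ⊤ ∧
      HaarMeager (L : Set (ℕ → ℝ)) ∧
      HaarNull (L : Set (ℕ → ℝ)) ∧
      ∀ F : ℕ → Set (ℕ → ℝ), (∀ n, IsClosed (F n)) → (∀ n, HaarMeager (F n)) →
        ¬ (L : Set (ℕ → ℝ)) ⊆ ⋃ n, F n := by
  have hmeas := measurableSet_span_range BoxFamily.continuous_point.measurable
    BoxFamily.linearIndependent_point
  have hone := BoxFamily.one_notMem_span
  refine ⟨Submodule.span ℝ (range BoxFamily.point), hmeas, ?_, haarMeager_of_notMem hone,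
    haarNull_of_notMem hmeas hone, fun F hclosed hF hcover => ?_⟩
  · exact fun htop => hone (htop ▸ Submodule.mem_top)
  obtain ⟨n, σ, hσ⟩ := nonempty_interior_of_iUnion_of_closed
    (fun n => (hclosed n).preimage BoxFamily.continuous_point)
    (eq_univ_of_forall fun σ => by
      simpa using mem_iUnion.1 (hcover (Submodule.subset_span (mem_range_self σ))))
  obtain ⟨_, ⟨ρ, k, rfl⟩, -, hsub⟩ :=
    (PiNat.isTopologicalBasis_cylinders (fun _ : ℕ => ℕ)).exists_subset_of_mem_open hσ
      isOpen_interior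
  exact BoxFamily.not_haarMeager_of_image_cylinder_subset (hclosed n)
    (image_subset_iff.2 (hsub.trans interior_subset)) (hF n)
end

section
/- There exists a subset P of ℝ^ω such that: (1) P is a G_δ subset of ℝ^ω; (2) P is linearly independent over ℝ; (3) for every family 𝓗 of closed Haar-meager subsets of ℝ^ω with cardinality |𝓗| strictly less than cov(𝓜), P is not contained in ⋃𝓗; and (4) the linear span of P is a meager Borel subset of ℝ^ω. -/
open Set Filter Topology Pointwise MeasureTheory

/-- `cov(𝓜)`: the smallest cardinality of a family of meager subsets of the Baire space
`ℕ → ℕ` covering the whole space. -/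
noncomputable def covMeager : Cardinal :=
  sInf { c : Cardinal | ∃ 𝓕 : Set (Set (ℕ → ℕ)),
    (∀ F ∈ 𝓕, IsMeagre F) ∧ ⋃₀ 𝓕 = Set.univ ∧ Cardinal.mk ↥𝓕 = c }

/-- A dense sequence of triples; the `k`-th letter of a sequence `z` of naturals encodes the triple
`blockData (z k)`. -/
noncomputable def blockData : ℕ → ℕ × (ℕ → ℕ) × (ℕ → unitInterval) :=
  TopologicalSpace.denseSeq _

/-- The number of initial letters of `z` which are visible at coordinate `n`. -/
noncomputable def visibleLength (z : ℕ → ℕ) (n : ℕ) : ℕ :=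
  ((Finset.range n).filter fun i => ∀ j ≤ i, (blockData (z j)).1 ≤ n).card

/-- The code of the visible part of `z` at coordinate `n`, together with a size parameter. -/
noncomputable def visibleCode (z : ℕ → ℕ) (n : ℕ) : ℕ :=
  Nat.pair (Encodable.encode ((List.range (visibleLength z n)).map z))
    ((blockData (z (visibleLength z n))).2.1 n)

/-- The order of magnitude of the `n`-th coordinate. -/
noncomputable def amplitude (z : ℕ → ℕ) (n : ℕ) : ℝ :=
  ((n : ℝ) + 3) ^ (visibleCode z n + 1)

/-- The relative position of the `n`-th coordinate, a number in `[0, 1]`. -/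
noncomputable def position (z : ℕ → ℕ) (n : ℕ) : ℝ :=
  ∑' j : ℕ, (1 / 2 : ℝ) ^ (j + 1) * ((blockData (z j)).2.2 n : ℝ)

/-- The parametrization of the linearly independent set. -/
noncomputable def embedSeq (z : ℕ → ℕ) (n : ℕ) : ℝ :=
  amplitude z n * (1 + position z n)

lemma visibleLength_le (z : ℕ → ℕ) (n : ℕ) : visibleLength z n ≤ n :=
  (Finset.card_filter_le _ _).trans_eq (Finset.card_range n)

lemma visibleLength_congr {z z' : ℕ → ℕ} {n : ℕ} (h : ∀ j ≤ n, z j = z' j) :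
    visibleLength z n = visibleLength z' n := by
  unfold visibleLength
  congr 1
  refine Finset.filter_congr fun i hi => ?_
  have hi' := Finset.mem_range.1 hi
  refine forall_congr' fun j => forall_congr' fun hj => ?_
  rw [h j (by omega)]

lemma visibleCode_congr {z z' : ℕ → ℕ} {n : ℕ} (h : ∀ j ≤ n, z j = z' j) :
    visibleCode z n = visibleCode z' n := by
  have hle := visibleLength_le z' n
  unfold visibleCode
  rw [visibleLength_congr h, h _ hle]
  congr 2
  refine List.map_congr_left fun j hj => h j ?_
  have := List.mem_range.1 hj
  omega

lemma eventually_lt_visibleLength (z : ℕ → ℕ) (k : ℕ) :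
    ∀ᶠ n in atTop, k < visibleLength z n := by
  have h : ∀ᶠ n in atTop, ∀ j ∈ Iic k, (blockData (z j)).1 ≤ n :=
    (eventually_all_finite (finite_Iic k)).2 fun j _ => eventually_ge_atTop _
  filter_upwards [h, eventually_gt_atTop k] with n hn hk
  have hsub : Finset.range (k + 1) ⊆
      (Finset.range n).filter fun i => ∀ j ≤ i, (blockData (z j)).1 ≤ n := by
    intro i hi
    have := Finset.mem_range.1 hi
    simp only [Finset.mem_filter, Finset.mem_range]
    exact ⟨by omega, fun j hj => hn j (by simp only [mem_Iic]; omega)⟩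
  have := Finset.card_le_card hsub
  rw [Finset.card_range] at this
  exact this

lemma eq_of_visibleCode_eq {z z' : ℕ → ℕ} {n k : ℕ} (h : visibleCode z n = visibleCode z' n)
    (hk : k < visibleLength z n) : z k = z' k := by
  unfold visibleCode at h
  have h1 := Encodable.encode_injective (Nat.pair_eq_pair.1 h).1
  have hlen : visibleLength z n = visibleLength z' n := by
    simpa using congrArg List.length h1
  rw [← hlen] at h1
  exact List.map_inj_left.1 h1 k (List.mem_range.2 hk)

lemma position_term_nonneg (z : ℕ → ℕ) (n j : ℕ) :
    0 ≤ (1 / 2 : ℝ) ^ (j + 1) * ((blockData (z j)).2.2 n : ℝ) :=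
  mul_nonneg (by positivity) (unitInterval.nonneg _)

lemma position_term_le (z : ℕ → ℕ) (n j : ℕ) :
    (1 / 2 : ℝ) ^ (j + 1) * ((blockData (z j)).2.2 n : ℝ) ≤ (1 / 2) ^ (j + 1) :=
  mul_le_of_le_one_right (by positivity) (unitInterval.le_one _)

lemma hasSum_half_pow_succ : HasSum (fun j : ℕ => (1 / 2 : ℝ) ^ (j + 1)) 1 := by
  simpa [pow_succ, div_eq_mul_inv] using hasSum_geometric_two.mul_right (1 / 2 : ℝ)

lemma summable_position (z : ℕ → ℕ) (n : ℕ) :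
    Summable fun j : ℕ => (1 / 2 : ℝ) ^ (j + 1) * ((blockData (z j)).2.2 n : ℝ) :=
  .of_nonneg_of_le (position_term_nonneg z n) (position_term_le z n)
    hasSum_half_pow_succ.summable

lemma position_nonneg (z : ℕ → ℕ) (n : ℕ) : 0 ≤ position z n :=
  tsum_nonneg (position_term_nonneg z n)

lemma position_le_one (z : ℕ → ℕ) (n : ℕ) : position z n ≤ 1 :=
  ((summable_position z n).tsum_le_tsum (position_term_le z n)
    hasSum_half_pow_succ.summable).trans_eq hasSum_half_pow_succ.tsum_eq

lemma amplitude_pos (z : ℕ → ℕ) (n : ℕ) : 0 < amplitude z n := by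
  unfold amplitude; positivity

lemma amplitude_le_embedSeq (z : ℕ → ℕ) (n : ℕ) : amplitude z n ≤ embedSeq z n :=
  le_mul_of_one_le_right (amplitude_pos z n).le (by linarith [position_nonneg z n])

lemma embedSeq_le (z : ℕ → ℕ) (n : ℕ) : embedSeq z n ≤ 2 * amplitude z n := by
  have := mul_le_mul_of_nonneg_left (position_le_one z n) (amplitude_pos z n).le
  unfold embedSeq
  linarith

lemma amplitude_mul_le {z z' : ℕ → ℕ} {n : ℕ} (h : visibleCode z n < visibleCode z' n) :
    ((n : ℝ) + 3) * amplitude z n ≤ amplitude z' n := by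
  unfold amplitude
  rw [← pow_succ']
  exact pow_le_pow_right₀ (by linarith [n.cast_nonneg (α := ℝ)]) (by omega)

lemma continuous_embedSeq : Continuous embedSeq := by
  refine continuous_pi fun n => ?_
  have hcode : Continuous fun z => visibleCode z n := by
    refine continuous_iff_continuousAt.2 fun z => ?_
    have h : ∀ᶠ z' in 𝓝 z, ∀ j ∈ Iic n, z' j = z j :=
      (eventually_all_finite (finite_Iic n)).2 fun j _ =>
        (continuous_apply j).continuousAt.eventually (eventually_of_mem
          ((isOpen_discrete {z j}).mem_nhds rfl) fun _ h => h)
    exact tendsto_nhds_of_eventually_eq (h.mono fun z' hz' => visibleCode_congr hz')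
  have hamp : Continuous fun z => amplitude z n :=
    (continuous_of_discreteTopology (f := fun c : ℕ => ((n : ℝ) + 3) ^ (c + 1))).comp hcode
  have hpos : Continuous fun z => position z n := by
    refine continuous_tsum (fun j => ?_) hasSum_half_pow_succ.summable fun j z => ?_
    · exact (continuous_of_discreteTopology
        (f := fun c : ℕ => (1 / 2 : ℝ) ^ (j + 1) * ((blockData c).2.2 n : ℝ))).comp
        (continuous_apply j)
    · rw [Real.norm_of_nonneg (position_term_nonneg z n j)]
      exact position_term_le z n j
  exact hamp.mul (continuous_const.add hpos)

/-- A continuous map from the Baire space whose inverse is well defined and locally constant in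
every coordinate on the range has a `G_δ` range. -/
lemma isGδ_range_of_forall_exists_open {Y : Type*} [TopologicalSpace Y]
    [TopologicalSpace.MetrizableSpace Y] {Φ : (ℕ → ℕ) → Y} (hΦ : Continuous Φ)
    (h : ∀ z k, ∃ U, IsOpen U ∧ Φ z ∈ U ∧ ∀ z', Φ z' ∈ U → z' k = z k) :
    IsGδ (range Φ) := by
  let O : ℕ → Set Y := fun k => ⋃₀ {U | IsOpen U ∧ ∃ c, ∀ z', Φ z' ∈ U → z' k = c}
  have hO : ∀ k, IsOpen (O k) := fun k => isOpen_sUnion fun U hU => hU.1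
  have hcl : IsGδ (closure (range Φ)) := by
    let := TopologicalSpace.metrizableSpaceMetric Y
    exact isClosed_closure.isGδ
  have heq : range Φ = closure (range Φ) ∩ ⋂ k, O k := by
    apply Subset.antisymm
    · rintro _ ⟨z, rfl⟩
      refine ⟨subset_closure ⟨z, rfl⟩, mem_iInter.2 fun k => ?_⟩
      obtain ⟨U, hU, hz, hU'⟩ := h z k
      exact ⟨U, ⟨hU, z k, hU'⟩, hz⟩
    · rintro x ⟨hx, hxO⟩
      choose U hU hxU using fun k => mem_sUnion.1 (mem_iInter.1 hxO k)
      choose hUo z hz using hU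
      have : (comap Φ (𝓝 x)).NeBot := comap_neBot_iff.2 fun t ht => by
        obtain ⟨_, hy, w, rfl⟩ := mem_closure_iff_nhds.1 hx t ht
        exact ⟨w, hy⟩
      have hlim : Tendsto id (comap Φ (𝓝 x)) (𝓝 z) := by
        refine tendsto_pi_nhds.2 fun k => tendsto_nhds_of_eventually_eq ?_
        exact (tendsto_comap.eventually ((hUo k).mem_nhds (hxU k))).mono fun w hw => hz k w hw
      exact ⟨z, tendsto_nhds_unique ((hΦ.tendsto z).comp hlim) tendsto_comap⟩
  rw [heq]
  exact hcl.inter (.iInter_of_isOpen hO)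

lemma isGδ_range_embedSeq : IsGδ (range embedSeq) := by
  refine isGδ_range_of_forall_exists_open continuous_embedSeq fun z k => ?_
  obtain ⟨n, hn⟩ := (eventually_lt_visibleLength z k).exists
  have hpos := amplitude_pos z n
  refine ⟨(fun x => x n) ⁻¹' Ioo (2 / 3 * amplitude z n) (3 * amplitude z n),
    isOpen_Ioo.preimage (continuous_apply n), ⟨?_, ?_⟩, fun z' ⟨h1, h2⟩ => ?_⟩
  · linarith [amplitude_le_embedSeq z n]
  · linarith [embedSeq_le z n]
  · have h3 := amplitude_le_embedSeq z' n
    have h4 := embedSeq_le z' n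
    have h5 := amplitude_pos z' n
    have hn0 : (0 : ℝ) ≤ n := n.cast_nonneg
    simp only at h1 h2
    rcases lt_trichotomy (visibleCode z n) (visibleCode z' n) with h | h | h
    · nlinarith [amplitude_mul_le h]
    · exact (eq_of_visibleCode_eq h hn).symm
    · nlinarith [amplitude_mul_le h]

lemma eventually_one_le_abs_sum (l : (ℕ → ℕ) →₀ ℝ) (hl : l ≠ 0) :
    ∀ᶠ n in atTop, 1 ≤ |Finsupp.linearCombination ℝ embedSeq l n| := by
  classical
  have hne : l.support.Nonempty := Finsupp.support_nonempty_iff.2 hl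
  obtain ⟨w, hw, hmin⟩ := l.support.exists_min_image (fun z => |l z|) hne
  have hτ : 0 < |l w| := abs_pos.2 (Finsupp.mem_support_iff.1 hw)
  set T := ∑ z ∈ l.support, |l z| with hT
  have hinj : ∀ᶠ n in atTop, ∀ z ∈ l.support, ∀ z' ∈ l.support,
      z ≠ z' → visibleCode z n ≠ visibleCode z' n := by
    refine (Finset.eventually_all _).2 fun z _ => (Finset.eventually_all _).2 fun z' _ => ?_
    by_cases hzz : z = z'
    · simp [hzz]
    · obtain ⟨k, hk⟩ := Function.ne_iff.1 hzz
      filter_upwards [eventually_lt_visibleLength z k] with n hn _ h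
      exact hk (eq_of_visibleCode_eq h hn)
  have hlarge : ∀ᶠ n : ℕ in atTop, (1 + 2 * T) / |l w| ≤ n :=
    tendsto_natCast_atTop_atTop.eventually_ge_atTop _
  filter_upwards [hinj, hlarge] with n hinj hn
  rw [div_le_iff₀ hτ] at hn
  obtain ⟨v, hv, hmax⟩ := l.support.exists_max_image (fun z => visibleCode z n) hne
  have hB : (0 : ℝ) < n + 3 := by positivity
  set a := amplitude v n / (n + 3) with ha
  have hva : amplitude v n = a * (n + 3) := by rw [ha]; field_simp
  have ha1 : 1 ≤ a := by
    have : a = ((n : ℝ) + 3) ^ visibleCode v n := by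
      rw [ha, amplitude, pow_succ]; field_simp
    rw [this]
    exact one_le_pow₀ (by linarith [n.cast_nonneg (α := ℝ)])
  have hsum : Finsupp.linearCombination ℝ embedSeq l n
      = l v * embedSeq v n + ∑ z ∈ l.support.erase v, l z * embedSeq z n := by
    rw [Finsupp.linearCombination_apply, Finsupp.sum, Finset.sum_apply,
      ← Finset.add_sum_erase _ _ hv]
    simp
  have hrest : |∑ z ∈ l.support.erase v, l z * embedSeq z n| ≤ 2 * a * T := by
    calc _ ≤ ∑ z ∈ l.support.erase v, |l z * embedSeq z n| := Finset.abs_sum_le_sum_abs _ _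
      _ ≤ ∑ z ∈ l.support.erase v, |l z| * (2 * a) := by
        refine Finset.sum_le_sum fun z hz => ?_
        obtain ⟨hzv, hz⟩ := Finset.mem_erase.1 hz
        have hlt : visibleCode z n < visibleCode v n :=
          lt_of_le_of_ne (hmax z hz) (hinj z hz v hv hzv)
        have h1 := amplitude_mul_le hlt
        rw [hva, mul_comm] at h1
        have h2 := le_of_mul_le_mul_right h1 hB
        have h3 := embedSeq_le z n
        have h4 := (amplitude_pos z n).le.trans (amplitude_le_embedSeq z n)
        rw [abs_mul, abs_of_nonneg h4]
        exact mul_le_mul_of_nonneg_left (by linarith) (abs_nonneg _)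
      _ ≤ T * (2 * a) := by
        rw [← Finset.sum_mul]
        refine mul_le_mul_of_nonneg_right ?_ (by linarith)
        exact Finset.sum_le_sum_of_subset_of_nonneg (Finset.erase_subset _ _)
          fun _ _ _ => abs_nonneg _
      _ = _ := by ring
  have hmain : |l w| * (a * (n + 3)) ≤ |l v * embedSeq v n| := by
    rw [abs_mul, ← hva]
    exact mul_le_mul (hmin v hv) ((amplitude_le_embedSeq v n).trans (le_abs_self _))
      (amplitude_pos v n).le (abs_nonneg _)
  have htri : |l v * embedSeq v n| ≤ |Finsupp.linearCombination ℝ embedSeq l n| +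
      |∑ z ∈ l.support.erase v, l z * embedSeq z n| := by
    rw [hsum]
    simpa using abs_sub (l v * embedSeq v n + ∑ z ∈ l.support.erase v, l z * embedSeq z n)
      (∑ z ∈ l.support.erase v, l z * embedSeq z n)
  nlinarith

lemma linearIndependent_embedSeq : LinearIndependent ℝ embedSeq := by
  rw [linearIndependent_iff]
  intro l hl
  by_contra hne
  obtain ⟨n, hn⟩ := (eventually_one_le_abs_sum l hne).exists
  rw [hl] at hn
  norm_num at hn

lemma isMeagre_setOf_one_le_abs (N : ℕ) :
    IsMeagre {x : ℕ → ℝ | ∀ n ≥ N, 1 ≤ |x n|} := by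
  have hc : IsClosed {x : ℕ → ℝ | ∀ n ≥ N, 1 ≤ |x n|} := by
    simp only [ofPred_forall]
    exact isClosed_iInter fun n => isClosed_iInter fun _ =>
      isClosed_le continuous_const (continuous_apply n).abs
  refine (hc.isNowhereDense_iff.2 ?_).isMeagre
  refine eq_empty_of_forall_notMem fun x hx => ?_
  have hlim : Tendsto (fun n => Function.update x n 0) atTop (𝓝 x) := by
    refine tendsto_pi_nhds.2 fun k => tendsto_nhds_of_eventually_eq ?_
    filter_upwards [eventually_gt_atTop k] with n hn
    exact Function.update_of_ne hn.ne _ _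
  obtain ⟨n, hn, hN⟩ :=
    ((hlim.eventually (mem_interior_iff_mem_nhds.1 hx)).and (eventually_ge_atTop N)).exists
  have := hn n hN
  norm_num at this

lemma isMeagre_span_range_embedSeq :
    IsMeagre (Submodule.span ℝ (range embedSeq) : Set (ℕ → ℝ)) := by
  have h0 : IsMeagre ({0} : Set (ℕ → ℝ)) :=
    (isClosed_singleton.isNowhereDense_iff.2 (interior_singleton _)).isMeagre
  refine (h0.union (isMeagre_iUnion isMeagre_setOf_one_le_abs)).mono ?_
  intro x hx
  obtain ⟨l, rfl⟩ := (Finsupp.mem_span_range_iff_exists_finsupp).1 hx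
  by_cases hl : l = 0
  · left; simp [hl]
  · right
    exact mem_iUnion.2 (eventually_atTop.1 (eventually_one_le_abs_sum l hl))

lemma exists_blockData_near (N : ℕ) (M : ℕ → ℕ) (q : ℕ → unitInterval) {ε : ℝ} (hε : 0 < ε) :
    ∃ a, (blockData a).1 = N ∧
      ∀ n < N, (blockData a).2.1 n = M n ∧ |((blockData a).2.2 n : ℝ) - q n| < ε := by
  let V : Set (ℕ × (ℕ → ℕ) × (ℕ → unitInterval)) :=
    {N} ×ˢ ((Iio N).pi fun n => {M n}) ×ˢ ((Iio N).pi fun n => Metric.ball (q n) ε)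
  have hV : IsOpen V := (isOpen_discrete _).prod
    ((isOpen_set_pi (finite_Iio N) fun _ _ => isOpen_discrete _).prod
      (isOpen_set_pi (finite_Iio N) fun _ _ => Metric.isOpen_ball))
  have hne : V.Nonempty :=
    ⟨(N, M, q), rfl, fun _ _ => rfl, fun _ _ => Metric.mem_ball_self hε⟩
  obtain ⟨a, ha1, ha2, ha3⟩ :=
    (TopologicalSpace.denseRange_denseSeq (ℕ × (ℕ → ℕ) × (ℕ → unitInterval))).exists_mem_open hV hne
  exact ⟨a, ha1, fun n hn => ⟨ha2 n hn, ha3 n hn⟩⟩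

/-- The sequence which agrees with `z` below `k`, takes the value `a` at `k` and vanishes
above `k`. -/
def splice (z : ℕ → ℕ) (k a : ℕ) (j : ℕ) : ℕ :=
  if j < k then z j else if j = k then a else 0

lemma splice_of_lt {z : ℕ → ℕ} {k a j : ℕ} (h : j < k) : splice z k a j = z j := if_pos h

lemma splice_self (z : ℕ → ℕ) (k a : ℕ) : splice z k a k = a := by simp [splice]

lemma splice_of_ne (z : ℕ → ℕ) {k j : ℕ} (a a' : ℕ) (h : j ≠ k) :
    splice z k a j = splice z k a' j := by simp [splice, h]

/-- The number of letters of `z` below `k` which are visible at coordinate `n`. -/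
noncomputable def stemLength (z : ℕ → ℕ) (k n : ℕ) : ℕ :=
  ((Finset.range n).filter fun i => i < k ∧ ∀ j ≤ i, (blockData (z j)).1 ≤ n).card

lemma stemLength_le (z : ℕ → ℕ) (k n : ℕ) : stemLength z k n ≤ k := by
  refine (Finset.card_le_card fun i hi => ?_).trans_eq (Finset.card_range k)
  exact Finset.mem_range.2 (Finset.mem_filter.1 hi).2.1

lemma eventually_stemLength_eq (z : ℕ → ℕ) (k : ℕ) :
    ∀ᶠ n in atTop, stemLength z k n = k := by
  have h : ∀ᶠ n in atTop, ∀ j ∈ Iio k, (blockData (z j)).1 ≤ n :=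
    (eventually_all_finite (finite_Iio k)).2 fun j _ => eventually_ge_atTop _
  filter_upwards [h, eventually_ge_atTop k] with n hn hk
  refine (stemLength_le z k n).antisymm ?_
  refine (Finset.card_range k).symm.trans_le (Finset.card_le_card fun i hi => ?_)
  have := Finset.mem_range.1 hi
  simp only [Finset.mem_filter, Finset.mem_range]
  exact ⟨by omega, this, fun j hj => hn j (by simp only [mem_Iio]; omega)⟩

lemma visibleLength_splice (z : ℕ → ℕ) {k a n : ℕ} (h : n < (blockData a).1) :
    visibleLength (splice z k a) n = stemLength z k n := by
  unfold visibleLength stemLength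
  congr 1
  refine Finset.filter_congr fun i _ => ?_
  constructor
  · intro hi
    have hik : i < k := by
      by_contra hki
      have := hi k (by omega)
      rw [splice_self] at this
      omega
    refine ⟨hik, fun j hj => ?_⟩
    have := hi j hj
    rwa [splice_of_lt (by omega)] at this
  · rintro ⟨hik, hi⟩ j hj
    rw [splice_of_lt (by omega)]
    exact hi j hj

/-- The common amplitude at coordinate `n` of the sequences `splice z k a` whose letter `a` is not
yet visible at `n` and has size parameters `M`. -/
noncomputable def stemAmplitude (z : ℕ → ℕ) (k : ℕ) (M : ℕ → ℕ) (n : ℕ) : ℝ :=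
  ((n : ℝ) + 3) ^ (Nat.pair (Encodable.encode ((List.range (stemLength z k n)).map z))
    (if stemLength z k n < k then (blockData (z (stemLength z k n))).2.1 n else M n) + 1)

lemma amplitude_splice (z : ℕ → ℕ) {k a n : ℕ} {M : ℕ → ℕ} (h : n < (blockData a).1)
    (hM : (blockData a).2.1 n = M n) :
    amplitude (splice z k a) n = stemAmplitude z k M n := by
  have hle := stemLength_le z k n
  unfold amplitude stemAmplitude visibleCode
  rw [visibleLength_splice z h]
  have hmap : (List.range (stemLength z k n)).map (splice z k a)
      = (List.range (stemLength z k n)).map z :=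
    List.map_congr_left fun j hj => splice_of_lt ((List.mem_range.1 hj).trans_le hle)
  rw [hmap]
  split_ifs with hlt
  · rw [splice_of_lt hlt]
  · rw [le_antisymm hle (not_lt.1 hlt), splice_self, hM]

lemma one_le_stemAmplitude (z : ℕ → ℕ) (k : ℕ) (M : ℕ → ℕ) (n : ℕ) :
    1 ≤ stemAmplitude z k M n :=
  one_le_pow₀ (by linarith [n.cast_nonneg (α := ℝ)])

lemma le_stemAmplitude (z : ℕ → ℕ) {k n : ℕ} (M : ℕ → ℕ) (h : stemLength z k n = k) :
    (M n : ℝ) ≤ stemAmplitude z k M n := by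
  unfold stemAmplitude
  rw [h, if_neg (lt_irrefl k)]
  set c := Nat.pair (Encodable.encode ((List.range k).map z)) (M n) with hc
  have h1 : M n ≤ c := Nat.right_le_pair _ _
  have h2 : c + 1 < (n + 3) ^ (c + 1) := Nat.lt_pow_self (by omega)
  exact_mod_cast (by omega : M n ≤ (n + 3) ^ (c + 1))

/-- The contribution to the position of `splice z k a` of all letters other than `a`. -/
noncomputable def stemPosition (z : ℕ → ℕ) (k n : ℕ) : ℝ :=
  ∑' j : ℕ, if j = k then 0 else
    (1 / 2 : ℝ) ^ (j + 1) * ((blockData (splice z k 0 j)).2.2 n : ℝ)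

lemma position_splice (z : ℕ → ℕ) (k a n : ℕ) :
    position (splice z k a) n
      = stemPosition z k n + (1 / 2 : ℝ) ^ (k + 1) * ((blockData a).2.2 n : ℝ) := by
  unfold position stemPosition
  rw [(summable_position (splice z k a) n).tsum_eq_add_tsum_ite k, splice_self, add_comm]
  congr 1
  refine tsum_congr fun j => ?_
  split_ifs with h
  · rfl
  · rw [splice_of_ne z a 0 h]

lemma mem_closure_image_cylinder (z : ℕ → ℕ) (k : ℕ) (M : ℕ → ℕ) (q : ℕ → unitInterval) :
    (fun n => stemAmplitude z k M n *
      (1 + (stemPosition z k n + (1 / 2 : ℝ) ^ (k + 1) * (q n : ℝ)))) ∈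
      closure (embedSeq '' {z' | ∀ j < k, z' j = z j}) := by
  choose a ha1 ha2 using fun N : ℕ =>
    exists_blockData_near N M q (ε := 1 / ((N : ℝ) + 1)) (by positivity)
  refine mem_closure_of_tendsto (b := atTop) (f := fun N => embedSeq (splice z k (a N))) ?_
    (Eventually.of_forall fun N => ⟨_, fun j hj => splice_of_lt hj, rfl⟩)
  refine tendsto_pi_nhds.2 fun n => ?_
  have hq : Tendsto (fun N => ((blockData (a N)).2.2 n : ℝ)) atTop (𝓝 (q n : ℝ)) := by
    rw [tendsto_iff_dist_tendsto_zero]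
    refine squeeze_zero' (Eventually.of_forall fun _ => dist_nonneg) ?_
      (tendsto_one_div_add_atTop_nhds_zero_nat (𝕜 := ℝ))
    filter_upwards [eventually_gt_atTop n] with N hN
    exact (ha2 N n hN).2.le
  refine Tendsto.congr' ?_
    (((hq.const_mul ((1 / 2 : ℝ) ^ (k + 1))).const_add (stemPosition z k n)).const_add 1
      |>.const_mul (stemAmplitude z k M n))
  filter_upwards [eventually_gt_atTop n] with N hN
  rw [embedSeq, position_splice,
    amplitude_splice z (by rw [ha1]; exact hN) (ha2 N n hN).1]

lemma not_image_cylinder_subset_of_haarMeager {H : Set (ℕ → ℝ)} (hH : IsClosed H)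
    (hm : HaarMeager H) (z : ℕ → ℕ) (k : ℕ) :
    ¬ embedSeq '' {z' | ∀ j < k, z' j = z j} ⊆ H := by
  intro hsub
  obtain ⟨f, hf, hmeagre⟩ := hm
  have hfn : ∀ n, Continuous fun t => f t n := fun n => (continuous_apply n).comp hf
  let t₀ : ℕ → Bool := fun _ => false
  have hbound : ∀ n, ∃ b : ℝ, ∀ t, |f t n - f t₀ n| ≤ b := fun n => by
    obtain ⟨b, hb⟩ := isCompact_univ.exists_bound_of_continuousOn
      ((hfn n).sub (continuous_const (y := f t₀ n))).continuousOn
    exact ⟨b, fun t => hb t (mem_univ t)⟩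
  choose b hb using hbound
  set e : ℝ := (1 / 2) ^ (k + 2) with he
  have hepos : 0 < e := by positivity
  have he2 : (1 / 2 : ℝ) ^ (k + 1) = 2 * e := by rw [he, pow_succ _ (k + 1)]; ring
  let M : ℕ → ℕ := fun n => ⌈b n / e⌉₊
  obtain ⟨n₀, hn₀⟩ := eventually_atTop.1 (eventually_stemLength_eq z k)
  let U : Set (ℕ → Bool) := ⋂ n ∈ Iio n₀, {t | |f t n - f t₀ n| < e}
  have hU : IsOpen U := (finite_Iio n₀).isOpen_biInter fun n _ =>
    isOpen_lt ((hfn n).sub continuous_const).abs continuous_const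
  have hUne : U.Nonempty := ⟨t₀, mem_iInter₂.2 fun n _ => by simpa using hepos⟩
  have hsmall : ∀ t ∈ U, ∀ n, |f t n - f t₀ n| ≤ e * stemAmplitude z k M n := by
    intro t ht n
    rcases lt_or_ge n n₀ with hn | hn
    · have h1 : |f t n - f t₀ n| < e := mem_iInter₂.1 ht n hn
      have h2 := one_le_stemAmplitude z k M n
      nlinarith
    · have h1 : b n / e ≤ stemAmplitude z k M n :=
        (Nat.le_ceil _).trans (le_stemAmplitude z M (hn₀ n hn))
      rw [div_le_iff₀ hepos, mul_comm] at h1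
      exact (hb n t).trans h1
  let w : ℕ → ℝ := fun n =>
    stemAmplitude z k M n * (1 + (stemPosition z k n + e)) - f t₀ n
  refine not_isMeagre_of_isOpen hU hUne ((hmeagre (-w)).mono fun t ht => ?_)
  refine ⟨f t + w, ?_, by simp⟩
  have hmem : ∀ n, 1 / 2 + (f t n - f t₀ n) / (2 * e * stemAmplitude z k M n) ∈
      unitInterval := fun n => by
    have hA := one_le_stemAmplitude z k M n
    have hpos : 0 < 2 * e * stemAmplitude z k M n := by positivity
    have h := abs_le.1 (hsmall t ht n)
    have h1 : (f t n - f t₀ n) / (2 * e * stemAmplitude z k M n) ≤ 1 / 2 := by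
      rw [div_le_iff₀ hpos]; linarith
    have h2 : -(1 / 2) ≤ (f t n - f t₀ n) / (2 * e * stemAmplitude z k M n) := by
      rw [le_div_iff₀ hpos]; linarith
    exact ⟨by linarith, by linarith⟩
  have hcl := mem_closure_image_cylinder z k M fun n => ⟨_, hmem n⟩
  convert closure_minimal hsub hH hcl using 1
  funext n
  have hA := one_le_stemAmplitude z k M n
  simp only [Pi.add_apply, w, he2]
  field_simp
  ring

lemma isMeagre_preimage_embedSeq {H : Set (ℕ → ℝ)} (hH : IsClosed H) (hm : HaarMeager H) :
    IsMeagre (embedSeq ⁻¹' H) := by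
  refine ((hH.preimage continuous_embedSeq).isNowhereDense_iff.2 ?_).isMeagre
  refine eq_empty_of_forall_notMem fun z hz => ?_
  have hz' := mem_interior_iff_mem_nhds.1 hz
  have hnot : ∀ k, ∃ y : ℕ → ℕ, (∀ j < k, y j = z j) ∧ embedSeq y ∉ H := fun k => by
    by_contra! hcon
    refine not_image_cylinder_subset_of_haarMeager hH hm z k ?_
    rintro _ ⟨y, hy, rfl⟩
    exact hcon y hy
  choose y hy hyH using hnot
  have hlim : Tendsto y atTop (𝓝 z) := by
    refine tendsto_pi_nhds.2 fun j => tendsto_nhds_of_eventually_eq ?_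
    filter_upwards [eventually_gt_atTop j] with k hk using hy k j hk
  obtain ⟨k, hk⟩ := (hlim.eventually hz').exists
  exact hyH k hk

lemma measurableSet_span_range_s1 {E : Type*} [AddCommGroup E] [Module ℝ E] [TopologicalSpace E]
    [T2Space E] [ContinuousAdd E] [ContinuousSMul ℝ E] [MeasurableSpace E]
    [OpensMeasurableSpace E] {Φ : (ℕ → ℕ) → E} (hΦ : Continuous Φ)
    (hli : LinearIndependent ℝ Φ) :
    MeasurableSet (Submodule.span ℝ (range Φ) : Set E) := by
  let D : (Σ p : ℕ × ℕ, Fin p.1 → Fin p.2 → ℕ) → Set E := fun σ =>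
    (fun x : (Fin σ.1.1 → ℕ → ℕ) × (Fin σ.1.1 → ℝ) => ∑ i, x.2 i • Φ (x.1 i)) ''
      {x | Function.Injective σ.2 ∧ (∀ i, (fun j : Fin σ.1.2 => x.1 i j) = σ.2 i) ∧
        ∀ i, x.2 i ≠ 0}
  have hD : ∀ σ, MeasurableSet (D σ) := by
    rintro ⟨⟨k, n⟩, σ⟩
    by_cases hσ : Function.Injective σ
    swap
    · simp [D, hσ]
    refine MeasurableSet.image_of_continuousOn_injOn ?_ ?_ ?_
    · simp only [hσ, true_and]
      refine IsOpen.measurableSet ?_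
      rw [ofPred_and, ofPred_forall, ofPred_forall]
      refine (isOpen_iInter_of_finite fun i => ?_).inter (isOpen_iInter_of_finite fun i => ?_)
      · exact (isOpen_discrete {σ i}).preimage (by fun_prop)
      · exact isOpen_ne_fun (by fun_prop) continuous_const
    · exact Continuous.continuousOn (by fun_prop)
    · rintro ⟨y, t⟩ ⟨-, hy, ht⟩ ⟨y', t'⟩ ⟨-, hy', ht'⟩ hyt
      simp only at hy ht hy' ht' hyt
      have hinj : Function.Injective y := fun i j hij => hσ (by rw [← hy i, ← hy j, hij])
      have hfin : ∑ i, Finsupp.single (y i) (t i) = ∑ i, Finsupp.single (y' i) (t' i) :=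
        hli (by simpa using hyt)
      have hyy : y = y' := by
        funext i
        have h1 : (∑ j, Finsupp.single (y j) (t j)) (y i) = t i := by
          rw [Finsupp.finsetSum_apply, Finset.sum_eq_single i]
          · simp
          · intro j _ hj
            exact Finsupp.single_eq_of_ne (hinj.ne hj.symm)
          · simp
        rw [hfin, Finsupp.finsetSum_apply] at h1
        obtain ⟨j, -, hj⟩ := Finset.exists_ne_zero_of_sum_ne_zero (h1.trans_ne (ht i))
        have hji : y' j = y i := by
          by_contra hne
          exact hj (Finsupp.single_eq_of_ne (Ne.symm hne))
        have : j = i := hσ (by rw [← hy' j, ← hy i, hji])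
        rw [← hji, this]
      subst hyy
      have hzero : ∑ i, (t i - t' i) • Φ (y i) = 0 := by
        simp only [sub_smul, Finset.sum_sub_distrib]
        exact sub_eq_zero.2 hyt
      have := Fintype.linearIndependent_iff.1 (hli.comp y hinj) (fun i => t i - t' i) hzero
      exact Prod.ext rfl (funext fun i => sub_eq_zero.1 (this i))
  have heq : (Submodule.span ℝ (range Φ) : Set E) = ⋃ σ, D σ := by
    apply Subset.antisymm
    · intro x hx
      obtain ⟨l, rfl⟩ := Finsupp.mem_span_range_iff_exists_finsupp.1 hx
      have hsep : ∀ᶠ n in atTop, ∀ z ∈ l.support, ∀ z' ∈ l.support,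
          (∀ j < n, z j = z' j) → z = z' := by
        refine (Finset.eventually_all _).2 fun z _ => (Finset.eventually_all _).2 fun z' _ => ?_
        by_cases hzz : z = z'
        · simp [hzz]
        · obtain ⟨j, hj⟩ := Function.ne_iff.1 hzz
          filter_upwards [eventually_gt_atTop j] with n hn h
          exact absurd (h j hn) hj
      obtain ⟨n, hn⟩ := hsep.exists
      let y : Fin l.support.card → ℕ → ℕ := fun i => l.support.equivFin.symm i
      refine mem_iUnion.2 ⟨⟨(l.support.card, n), fun i j => y i j⟩, (y, fun i => l (y i)),
        ⟨fun i i' h => ?_, fun i => rfl, fun i => ?_⟩, ?_⟩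
      · refine l.support.equivFin.symm.injective (Subtype.ext ?_)
        exact hn _ (l.support.equivFin.symm i).2 _ (l.support.equivFin.symm i').2
          fun j hj => congrFun h ⟨j, hj⟩
      · exact Finsupp.mem_support_iff.1 (l.support.equivFin.symm i).2
      · simp only [y]
        rw [Finsupp.sum, ← Finset.sum_coe_sort l.support]
        exact Equiv.sum_comp l.support.equivFin.symm fun z => l z • Φ z
    · refine iUnion_subset fun σ => ?_
      rintro _ ⟨x, -, rfl⟩
      exact Submodule.sum_mem _ fun i _ =>
        Submodule.smul_mem _ _ (Submodule.subset_span ⟨_, rfl⟩)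
  rw [heq]
  exact .iUnion hD

/-- `ℝ^ω` contains a `G_δ` linearly independent set `P` which cannot be covered by fewer than
`cov(𝓜)` closed Haar-meager sets, and whose linear span is a meager Borel subspace. -/
theorem statement1 :
    ∃ P : Set (ℕ → ℝ),
      IsGδ P ∧
      LinearIndependent ℝ ((↑) : P → (ℕ → ℝ)) ∧
      (∀ 𝓗 : Set (Set (ℕ → ℝ)), (∀ H ∈ 𝓗, IsClosed H ∧ HaarMeager H) →
        Cardinal.mk ↥𝓗 < covMeager → ¬ P ⊆ ⋃₀ 𝓗) ∧
      IsMeagre (Submodule.span ℝ P : Set (ℕ → ℝ)) ∧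
      MeasurableSet (Submodule.span ℝ P : Set (ℕ → ℝ)) := by
  refine ⟨range embedSeq, isGδ_range_embedSeq, linearIndependent_embedSeq.linearIndepOn_id,
    fun 𝓗 h𝓗 hcard hcover => ?_, isMeagre_span_range_embedSeq,
    measurableSet_span_range_s1 continuous_embedSeq linearIndependent_embedSeq⟩
  refine hcard.not_ge (le_trans (csInf_le' ⟨preimage embedSeq '' 𝓗, ?_, ?_, rfl⟩)
    Cardinal.mk_image_le)
  · rintro _ ⟨H, hH, rfl⟩
    exact isMeagre_preimage_embedSeq (h𝓗 H hH).1 (h𝓗 H hH).2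
  · refine eq_univ_of_forall fun z => ?_
    obtain ⟨H, hH, hz⟩ := hcover ⟨z, rfl⟩
    exact ⟨_, ⟨H, hH, rfl⟩, hz⟩
end

section
/- Let n be a positive integer, X = ℝ^n, and let A be a Borel subset of X that cannot be covered by countably many closed sets of Lebesgue measure zero (i.e., for every sequence (F_k) of closed subsets of ℝ^n with Lebesgue measure zero, A is not contained in ⋃_k F_k). Then A belongs to the Kuczma–Ger class 𝓑_X: every additive function f : ℝ^n → ℝ with sup f[A] < ∞ is continuous. -/
open Set Filter Topology MeasureTheory

open scoped Pointwise

/-- **Steinhaus theorem** for the sum of two sets of positive Haar measure. -/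
theorem interior_add_nonempty_of_addHaar_pos {G : Type*} [AddCommGroup G] [TopologicalSpace G]
    [IsTopologicalAddGroup G] [LocallyCompactSpace G] [SecondCountableTopology G]
    [MeasurableSpace G] [BorelSpace G] (μ : Measure G) [μ.IsAddHaarMeasure] [μ.InnerRegular]
    [SigmaFinite μ] {S T : Set G} (hS : MeasurableSet S) (hT : MeasurableSet T)
    (hSpos : μ S ≠ 0) (hTpos : μ T ≠ 0) : (interior (S + T)).Nonempty := by
  have hE : MeasurableSet {p : G × G | p.2 ∈ S ∧ p.1 - p.2 ∈ T} :=
    (measurable_snd hS).inter ((measurable_fst.sub measurable_snd) hT)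
  obtain ⟨x, hx⟩ : ∃ x, μ {y | y ∈ S ∧ x - y ∈ T} ≠ 0 := by
    by_contra! h
    have h0 : (μ.prod μ) {p : G × G | p.2 ∈ S ∧ p.1 - p.2 ∈ T} = 0 :=
      (Measure.measure_prod_null hE).2 (Eventually.of_forall h)
    rw [← (measurePreserving_add_prod μ μ).measure_preimage hE.nullMeasurableSet] at h0
    have hST : (fun z : G × G ↦ (z.1 + z.2, z.2)) ⁻¹' {p | p.2 ∈ S ∧ p.1 - p.2 ∈ T} = T ×ˢ S := by
      ext ⟨t, s⟩
      simp [and_comm]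
    rw [hST, Measure.prod_prod, mul_eq_zero] at h0
    exact h0.elim hTpos hSpos
  have hD : MeasurableSet {y | y ∈ S ∧ x - y ∈ T} :=
    hS.inter ((measurable_const.sub measurable_id) hT)
  have hnhds := Measure.sub_mem_nhds_zero_of_addHaar_pos μ _ hD (pos_iff_ne_zero.2 hx)
  refine ⟨x, mem_interior_iff_mem_nhds.2 ?_⟩
  have htend : Tendsto (fun z : G ↦ z - x) (𝓝 x) (𝓝 0) := by
    simpa using (continuous_id.sub continuous_const).tendsto (x := x) (f := fun z : G ↦ z - x)
  filter_upwards [htend hnhds] with z hz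
  obtain ⟨a, ha, b, hb, hab⟩ := mem_sub.1 hz
  refine mem_add.2 ⟨a, ha.1, x - b, hb.2, ?_⟩
  rw [add_sub_left_comm, hab, add_sub_cancel]

/-- A map is *somewhere dense on open sets* if the image of each nonempty open set is dense in
some nonempty open set. -/
def SomewhereDenseOnOpens {Q X : Type*} [TopologicalSpace Q] [TopologicalSpace X]
    (φ : Q → X) : Prop :=
  ∀ V : Set Q, IsOpen V → V.Nonempty → (interior (closure (φ '' V))).Nonempty

theorem SomewhereDenseOnOpens.exists_shrink {Q X : Type*} [PseudoMetricSpace Q]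
    [TopologicalSpace X] {φ : Q → X} (hφ : SomewhereDenseOnOpens φ) (hc : Continuous φ)
    {V : Set Q} {O : Set X} (hV : IsOpen V) (hO : IsOpen O) (hne : O.Nonempty)
    (hOV : O ⊆ closure (φ '' V)) {ε : ℝ} (hε : 0 < ε) :
    ∃ V' ⊆ V, ∃ O' ⊆ O, IsOpen V' ∧ IsOpen O' ∧ O'.Nonempty ∧ O' ⊆ closure (φ '' V') ∧
      ∀ a ∈ V', ∀ b ∈ V', dist a b ≤ ε := by
  obtain ⟨x, hx⟩ := hne
  obtain ⟨_, hvO, v, hv, rfl⟩ := mem_closure_iff.1 (hOV hx) O hO hx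
  have hV' : IsOpen (V ∩ φ ⁻¹' O ∩ Metric.ball v (ε / 2)) :=
    (hV.inter (hO.preimage hc)).inter Metric.isOpen_ball
  obtain ⟨y, hy⟩ := hφ _ hV' ⟨v, ⟨hv, hvO⟩, Metric.mem_ball_self (by positivity)⟩
  refine ⟨_, fun a ha ↦ ha.1.1, interior (closure (φ '' (V ∩ φ ⁻¹' O ∩ Metric.ball v (ε / 2)))) ∩ O,
    inter_subset_right, hV', isOpen_interior.inter hO, ?_,
    fun a ha ↦ interior_subset ha.1, fun a ha b hb ↦ ?_⟩
  · have hsub : φ '' (V ∩ φ ⁻¹' O ∩ Metric.ball v (ε / 2)) ⊆ O := by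
      rintro _ ⟨a, ha, rfl⟩
      exact ha.1.2
    exact mem_closure_iff.1 (closure_mono hsub (interior_subset hy)) _ isOpen_interior hy
  · have h1 := Metric.mem_ball.1 ha.2
    have h2 := Metric.mem_ball.1 hb.2
    linarith [dist_triangle_right a b v]

/-- Two continuous maps on complete metric spaces that are somewhere dense on open sets, and whose
ranges are dense in a common nonempty open set, have a common value. -/
theorem SomewhereDenseOnOpens.exists_eq {Q R X : Type*} [MetricSpace Q] [CompleteSpace Q]
    [MetricSpace R] [CompleteSpace R] [MetricSpace X] {φ : Q → X} {ψ : R → X}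
    (hφ : SomewhereDenseOnOpens φ) (hψ : SomewhereDenseOnOpens ψ)
    (hφc : Continuous φ) (hψc : Continuous ψ) {O : Set X} (hO : IsOpen O) (hne : O.Nonempty)
    (hOφ : O ⊆ closure (range φ)) (hOψ : O ⊆ closure (range ψ)) : ∃ p r, φ p = ψ r := by
  let good : Set Q × Set R × Set X → Prop := fun s ↦ IsOpen s.1 ∧ IsOpen s.2.1 ∧ IsOpen s.2.2 ∧
    s.2.2.Nonempty ∧ s.2.2 ⊆ closure (φ '' s.1) ∧ s.2.2 ⊆ closure (ψ '' s.2.1)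
  have step : ∀ (ε : ℝ), 0 < ε → ∀ s : {s // good s}, ∃ t : {s // good s},
      t.1.1 ⊆ s.1.1 ∧ t.1.2.1 ⊆ s.1.2.1 ∧ (∀ a ∈ t.1.1, ∀ b ∈ t.1.1, dist a b ≤ ε) ∧
        ∀ a ∈ t.1.2.1, ∀ b ∈ t.1.2.1, dist a b ≤ ε := by
    rintro ε hε ⟨⟨V, W, U⟩, hV, hW, hU, hUne, hUV, hUW⟩
    obtain ⟨V', hV'V, U', hU'U, hV', hU', hU'ne, hU'V', hdV⟩ :=
      hφ.exists_shrink hφc hV hU hUne hUV hε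
    obtain ⟨W', hW'W, U'', hU''U', hW', hU'', hU''ne, hU''W', hdW⟩ :=
      hψ.exists_shrink hψc hW hU' hU'ne (hU'U.trans hUW) hε
    exact ⟨⟨⟨V', W', U''⟩, hV', hW', hU'', hU''ne, hU''U'.trans hU'V', hU''W'⟩,
      hV'V, hW'W, hdV, hdW⟩
  have hpos : ∀ k : ℕ, (0 : ℝ) < 1 / (k + 1) := fun k ↦ by positivity
  choose next hnext using fun k : ℕ ↦ step (1 / (k + 1)) (hpos k)
  let s : ℕ → {s // good s} := fun k ↦ Nat.rec
    ⟨⟨univ, univ, O⟩, isOpen_univ, isOpen_univ, hO, hne, by simpa using hOφ, by simpa using hOψ⟩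
    next k
  have hs : ∀ k, s (k + 1) = next k (s k) := fun k ↦ rfl
  have hVanti : Antitone fun k ↦ (s k).1.1 :=
    antitone_nat_of_succ_le fun k ↦ by rw [hs]; exact (hnext k (s k)).1
  have hWanti : Antitone fun k ↦ (s k).1.2.1 :=
    antitone_nat_of_succ_le fun k ↦ by rw [hs]; exact (hnext k (s k)).2.1
  have hpick : ∀ k : ℕ, ∃ p ∈ (s (k + 1)).1.1, ∃ r ∈ (s (k + 1)).1.2.1,
      dist (φ p) (ψ r) ≤ 1 / (k + 1) := by
    intro k
    obtain ⟨-, -, -, ⟨x, hx⟩, h1, h2⟩ := (s (k + 1)).2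
    obtain ⟨_, ⟨p, hp, rfl⟩, hpx⟩ := Metric.mem_closure_iff.1 (h1 hx) _ (half_pos (hpos k))
    obtain ⟨_, ⟨r, hr, rfl⟩, hrx⟩ := Metric.mem_closure_iff.1 (h2 hx) _ (half_pos (hpos k))
    exact ⟨p, hp, r, hr, by linarith [dist_triangle_left (φ p) (ψ r) x]⟩
  choose p hp r hr hpr using hpick
  have hlim : Tendsto (fun k : ℕ ↦ (1 : ℝ) / (k + 1)) atTop (𝓝 0) :=
    tendsto_one_div_add_atTop_nhds_zero_nat
  have hpc : CauchySeq p := cauchySeq_of_le_tendsto_0 _ (fun a b N ha hb ↦ by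
    have h := (hnext N (s N)).2.2.1
    rw [← hs] at h
    exact h _ (hVanti (Nat.succ_le_succ ha) (hp a)) _ (hVanti (Nat.succ_le_succ hb) (hp b))) hlim
  have hrc : CauchySeq r := cauchySeq_of_le_tendsto_0 _ (fun a b N ha hb ↦ by
    have h := (hnext N (s N)).2.2.2
    rw [← hs] at h
    exact h _ (hWanti (Nat.succ_le_succ ha) (hr a)) _ (hWanti (Nat.succ_le_succ hb) (hr b))) hlim
  obtain ⟨p₀, hp₀⟩ := cauchySeq_tendsto_of_complete hpc
  obtain ⟨r₀, hr₀⟩ := cauchySeq_tendsto_of_complete hrc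
  refine ⟨p₀, r₀, dist_le_zero.1 (le_of_tendsto_of_tendsto' ?_ hlim hpr)⟩
  exact ((hφc.tendsto p₀).comp hp₀).dist ((hψc.tendsto r₀).comp hr₀)

/-- If a continuous map `φ` on a nonempty Polish space is somewhere dense on open sets, then
`range φ + range φ` has nonempty interior. -/
theorem SomewhereDenseOnOpens.interior_range_add_range_nonempty {Q E : Type*} [TopologicalSpace Q]
    [PolishSpace Q] [Nonempty Q] [NormedAddCommGroup E] {φ : Q → E}
    (hφ : SomewhereDenseOnOpens φ) (hc : Continuous φ) :
    (interior (range φ + range φ)).Nonempty := by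
  let := TopologicalSpace.upgradeIsCompletelyMetrizable Q
  obtain ⟨c, hcO⟩ := hφ univ isOpen_univ univ_nonempty
  rw [image_univ] at hcO
  set O := interior (closure (range φ))
  have hO : IsOpen O := isOpen_interior
  refine ⟨c + c, mem_interior_iff_mem_nhds.2 ?_⟩
  have hpre : (fun z : E ↦ z - c) ⁻¹' O ∈ 𝓝 (c + c) :=
    (hO.preimage (continuous_id.sub continuous_const)).mem_nhds (by simpa using hcO)
  filter_upwards [hpre] with z hz
  let h : E ≃ₜ E := Homeomorph.subLeft z
  have hψ : SomewhereDenseOnOpens (h ∘ φ) := fun V hV hVne ↦ by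
    rw [image_comp, ← h.image_closure, ← h.image_interior]
    exact (hφ V hV hVne).image h
  have hne : (O ∩ h ⁻¹' O).Nonempty := ⟨c, hcO, hz⟩
  obtain ⟨p, r, hpr⟩ := hφ.exists_eq hψ hc (h.continuous.comp hc)
    (hO.inter (hO.preimage h.continuous)) hne (fun x hx ↦ interior_subset hx.1) (fun x hx ↦ by
      rw [range_comp, ← h.image_closure]
      exact ⟨z - x, interior_subset hx.2, sub_sub_cancel z x⟩)
  refine mem_add.2 ⟨φ p, mem_range_self p, φ r, mem_range_self r, ?_⟩
  rw [hpr]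
  exact sub_add_cancel z (φ r)

/-- A set is in the σ-ideal generated by closed `μ`-null sets. -/
def ClosedNullCoverable {X : Type*} [TopologicalSpace X] [MeasurableSpace X] (μ : Measure X)
    (S : Set X) : Prop :=
  ∃ F : ℕ → Set X, (∀ k, IsClosed (F k)) ∧ (∀ k, μ (F k) = 0) ∧ S ⊆ ⋃ k, F k

namespace ClosedNullCoverable

variable {X : Type*} [TopologicalSpace X] [MeasurableSpace X] {μ : Measure X}

theorem mono {S T : Set X} (hT : ClosedNullCoverable μ T) (hST : S ⊆ T) :
    ClosedNullCoverable μ S :=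
  let ⟨F, hF, h0, hTF⟩ := hT
  ⟨F, hF, h0, hST.trans hTF⟩

theorem of_closure_null {S : Set X} (hS : μ (closure S) = 0) : ClosedNullCoverable μ S :=
  ⟨fun _ ↦ closure S, fun _ ↦ isClosed_closure, fun _ ↦ hS,
    subset_closure.trans (subset_iUnion (fun _ : ℕ ↦ closure S) 0)⟩

theorem iUnion {S : ℕ → Set X} (hS : ∀ i, ClosedNullCoverable μ (S i)) :
    ClosedNullCoverable μ (⋃ i, S i) := by
  choose F hF h0 hSF using hS
  refine ⟨fun k ↦ F k.unpair.1 k.unpair.2, fun _ ↦ hF _ _, fun _ ↦ h0 _ _, ?_⟩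
  rw [iUnion_unpair]
  exact iUnion_mono hSF

theorem sUnion {𝒮 : Set (Set X)} (hc : 𝒮.Countable) (h : ∀ S ∈ 𝒮, ClosedNullCoverable μ S) :
    ClosedNullCoverable μ (⋃₀ 𝒮) := by
  rcases 𝒮.eq_empty_or_nonempty with rfl | hne
  · exact of_closure_null (by simp)
  · obtain ⟨S, rfl⟩ := hc.exists_eq_range hne
    rw [sUnion_range]
    exact iUnion fun i ↦ h _ (mem_range_self i)

theorem union {S T : Set X} (hS : ClosedNullCoverable μ S) (hT : ClosedNullCoverable μ T) :
    ClosedNullCoverable μ (S ∪ T) := by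
  rw [← sUnion_pair]
  refine sUnion (by simp) ?_
  rintro _ (rfl | rfl) <;> assumption

end ClosedNullCoverable

/-- A continuous map from a Polish space whose range is not covered by countably many closed null
sets restricts to a nonempty closed subset on which every nonempty relatively open set has an image
with non-null closure. -/
theorem exists_isClosed_forall_closure_image_ne_zero {P X : Type*} [TopologicalSpace P]
    [SecondCountableTopology P] [TopologicalSpace X] [MeasurableSpace X] {μ : Measure X}
    {g : P → X} (hg : ¬ ClosedNullCoverable μ (range g)) :
    ∃ C : Set P, IsClosed C ∧ C.Nonempty ∧
      ∀ V, IsOpen V → (V ∩ C).Nonempty → μ (closure (g '' (V ∩ C))) ≠ 0 := by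
  set 𝒰 : Set (Set P) := {V | IsOpen V ∧ ClosedNullCoverable μ (g '' V)}
  have hU : ClosedNullCoverable μ (g '' ⋃₀ 𝒰) := by
    obtain ⟨T, hTc, hT𝒰, hTU⟩ := TopologicalSpace.isOpen_sUnion_countable 𝒰 fun V hV ↦ hV.1
    rw [← hTU, image_sUnion]
    refine .sUnion (hTc.image _) ?_
    rintro _ ⟨V, hV, rfl⟩
    exact (hT𝒰 hV).2
  refine ⟨(⋃₀ 𝒰)ᶜ, (isOpen_sUnion fun V hV ↦ hV.1).isClosed_compl, ?_, fun V hV hne h0 ↦ ?_⟩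
  · rw [nonempty_compl]
    intro h
    rw [h, image_univ] at hU
    exact hg hU
  · have hV𝒰 : V ∈ 𝒰 := by
      refine ⟨hV, ((ClosedNullCoverable.of_closure_null h0).union hU).mono ?_⟩
      rw [← image_union]
      refine image_mono fun x hx ↦ ?_
      by_cases hxU : x ∈ ⋃₀ 𝒰
      · exact .inr hxU
      · exact .inl ⟨hx, hxU⟩
    obtain ⟨x, hxV, hxU⟩ := hne
    exact hxU ⟨V, hV𝒰, hxV⟩

/-- If an analytic set `A` is not covered by countably many closed null sets, then the fourfold sum
`(A + A) + (A + A)` has nonempty interior. -/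
theorem MeasureTheory.AnalyticSet.interior_add_add_add_nonempty {E : Type*} [NormedAddCommGroup E]
    [LocallyCompactSpace E] [SecondCountableTopology E] [MeasurableSpace E] [BorelSpace E]
    (μ : Measure E) [μ.IsAddHaarMeasure] [μ.InnerRegular] [SigmaFinite μ] {A : Set E}
    (hA : AnalyticSet A) (hcov : ¬ ClosedNullCoverable μ A) :
    (interior ((A + A) + (A + A))).Nonempty := by
  rw [AnalyticSet] at hA
  obtain rfl | ⟨g, hg, rfl⟩ := hA
  · exact absurd (.of_closure_null (by simp)) hcov
  obtain ⟨C, hC, hCne, hpos⟩ := exists_isClosed_forall_closure_image_ne_zero hcov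
  have : PolishSpace C := hC.polishSpace
  have : Nonempty C := hCne.to_subtype
  have hpos' : ∀ V : Set C, IsOpen V → V.Nonempty → μ (closure ((fun x : C ↦ g x) '' V)) ≠ 0 := by
    rintro _ ⟨V, hV, rfl⟩ ⟨x, hx⟩
    have h := hpos V hV ⟨x, hx, x.2⟩
    rwa [inter_comm, ← Subtype.image_preimage_coe, image_image] at h
  let φ : C × C → E := fun p ↦ g p.1 + g p.2
  have hφ : SomewhereDenseOnOpens φ := by
    rintro V hV ⟨⟨a, b⟩, hab⟩
    obtain ⟨S, T, hS, hT, ha, hb, hST⟩ := isOpen_prod_iff.1 hV a b hab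
    refine (interior_add_nonempty_of_addHaar_pos μ isClosed_closure.measurableSet
      isClosed_closure.measurableSet (hpos' S hS ⟨a, ha⟩) (hpos' T hT ⟨b, hb⟩)).mono
      (interior_mono ?_)
    rintro _ ⟨x, hx, y, hy, rfl⟩
    refine map_mem_closure₂ continuous_add hx hy ?_
    rintro _ ⟨s, hs, rfl⟩ _ ⟨t, ht, rfl⟩
    exact ⟨(s, t), hST ⟨hs, ht⟩, rfl⟩
  have hrange : range φ ⊆ range g + range g := by
    rintro _ ⟨p, rfl⟩
    exact add_mem_add (mem_range_self _) (mem_range_self _)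
  exact (hφ.interior_range_add_range_nonempty (by fun_prop)).mono
    (interior_mono (add_subset_add hrange hrange))

/-- An additive functional bounded above on a set with nonempty interior is continuous. -/
theorem AddMonoidHom.continuous_of_bddAbove_interior_nonempty {E : Type*} [NormedAddCommGroup E]
    [NormedSpace ℝ E] (f : E →+ ℝ) {S : Set E} (hS : (interior S).Nonempty)
    (hbdd : BddAbove (f '' S)) : Continuous f := by
  obtain ⟨c, hc⟩ := hS
  obtain ⟨M, hM⟩ := hbdd
  have hc' : S ∈ 𝓝 c := mem_interior_iff_mem_nhds.1 hc
  have h1 : (fun x ↦ c + x) ⁻¹' S ∈ 𝓝 (0 : E) :=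
    (continuous_const.add continuous_id).continuousAt.preimage_mem_nhds (by simpa using hc')
  have h2 : (fun x ↦ c - x) ⁻¹' S ∈ 𝓝 (0 : E) :=
    (continuous_const.sub continuous_id).continuousAt.preimage_mem_nhds (by simpa using hc')
  refine f.continuous_of_isBounded_nhds_zero (inter_mem h1 h2) ?_
  refine (Metric.isBounded_Icc (-(M - f c)) (M - f c)).subset ?_
  rintro _ ⟨x, ⟨hx1, hx2⟩, rfl⟩
  have h3 := hM (mem_image_of_mem f hx1)
  have h4 := hM (mem_image_of_mem f hx2)
  rw [map_add] at h3
  rw [map_sub] at h4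
  constructor <;> linarith

/-- If a Borel subset `A` of `ℝ^n` (for `n ≥ 1`) cannot be covered by countably many closed
sets of Lebesgue measure zero, then `A` belongs to the Kuczma–Ger class `𝓑`: every additive
`f : ℝ^n → ℝ` bounded above on `A` is continuous. -/
theorem statement18 (n : ℕ) (hn : 0 < n) (A : Set (Fin n → ℝ)) (hBorel : MeasurableSet A)
    (hcov : ∀ F : ℕ → Set (Fin n → ℝ), (∀ k, IsClosed (F k)) → (∀ k, volume (F k) = 0) →
      ¬ A ⊆ ⋃ k, F k)
    (f : (Fin n → ℝ) → ℝ) (hadd : ∀ x y : Fin n → ℝ, f (x + y) = f x + f y)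
    (hbdd : BddAbove (f '' A)) :
    Continuous f := by
  obtain ⟨M, hM⟩ := hbdd
  have hint := hBorel.analyticSet.interior_add_add_add_nonempty volume
    fun ⟨F, hF, h0, hAF⟩ ↦ hcov F hF h0 hAF
  refine (AddMonoidHom.mk' f hadd).continuous_of_bddAbove_interior_nonempty hint
    ⟨(M + M) + (M + M), ?_⟩
  rintro _ ⟨_, ⟨_, ⟨a, ha, b, hb, rfl⟩, _, ⟨c, hc, d, hd, rfl⟩, rfl⟩, rfl⟩
  have hle : ∀ x ∈ A, f x ≤ M := fun x hx ↦ hM (mem_image_of_mem f hx)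
  simp only [AddMonoidHom.mk'_apply, hadd]
  linarith [hle a ha, hle b hb, hle c hc, hle d hd]
end
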